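/- Let d ≥ 4 and let Δ be a prime normal d-pseudomanifold with g_2(Δ) ≥ 1. If u is a vertex of Δ such that lk_Δ u is prime, then g_2(lk_Δ u) ≥ 1. -/

import Mathlib

/-!
Common definitions: finite abstract simplicial complexes (with vertices in ℕ),
links, f-vectors, g-numbers, reduced simplicial homology over a field (via Betti
numbers of the simplicial chain complex), homology spheres/manifolds, geometric
realization and triangulated spheres/balls, normal pseudomanifolds, and the
combinatorial operations (bistellar moves, edge contraction/expansion, edge
flips) used in the paper.
-/

noncomputable section

/-- A finite abstract simplicial complex with vertex set contained in `ℕ`: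
a finite, downward closed family of finite sets (faces). -/
structure SComplex where
  faces : Finset (Finset ℕ)
  down : ∀ σ ∈ faces, ∀ τ ⊆ σ, τ ∈ faces

namespace SComplex

/-- The vertex set of a complex. -/
def vertexSet (Δ : SComplex) : Finset ℕ := Δ.faces.biUnion id

/-- The link of a face `σ`:
`lk_Δ σ = {γ ∈ Δ : γ ∩ σ = ∅ and γ ∪ σ ∈ Δ}`. -/
def link (Δ : SComplex) (σ : Finset ℕ) : SComplex where
  faces := Δ.faces.filter fun γ => γ ∩ σ = ∅ ∧ γ ∪ σ ∈ Δ.faces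
  down := by
    intro γ hγ τ hτ
    simp only [Finset.mem_filter] at hγ ⊢
    obtain ⟨h1, h2, h3⟩ := hγ
    refine ⟨Δ.down γ h1 τ hτ, ?_,
      Δ.down _ h3 _ (Finset.union_subset_union hτ (Finset.Subset.refl σ))⟩
    have h4 : τ ∩ σ ⊆ γ ∩ σ := Finset.inter_subset_inter hτ (Finset.Subset.refl σ)
    rw [h2] at h4
    exact Finset.subset_empty.mp h4

/-- The induced subcomplex on a set `W` of vertices. -/
def induced (Δ : SComplex) (W : Finset ℕ) : SComplex where
  faces := Δ.faces.filter fun σ => σ ⊆ W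
  down := by
    intro σ hσ τ hτ
    simp only [Finset.mem_filter] at hσ ⊢
    exact ⟨Δ.down σ hσ.1 τ hτ, hτ.trans hσ.2⟩

/-- `fVec Δ i = f_i(Δ)`, the number of `i`-dimensional faces. -/
def fVec (Δ : SComplex) (i : ℕ) : ℕ := (Δ.faces.filter fun σ => σ.card = i + 1).card

/-- `g₂` of a pure `d`-dimensional complex: `g₂ = f₁ - (d+1)·f₀ + C(d+2, 2)`. -/
def g2 (Δ : SComplex) (d : ℕ) : ℤ :=
  (Δ.fVec 1 : ℤ) - ((d : ℤ) + 1) * (Δ.fVec 0 : ℤ) + (Nat.choose (d + 2) 2 : ℤ)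

/-- `g₃` of a pure `d`-dimensional complex:
`g₃ = f₂ - d·f₁ + C(d+1,2)·f₀ - C(d+2,3)`. -/
def g3 (Δ : SComplex) (d : ℕ) : ℤ :=
  (Δ.fVec 2 : ℤ) - (d : ℤ) * (Δ.fVec 1 : ℤ) + (Nat.choose (d + 1) 2 : ℤ) * (Δ.fVec 0 : ℤ)
    - (Nat.choose (d + 2) 3 : ℤ)

/-- A complex is pure of dimension `d` if every face is contained in a face with
`d+1` vertices and no face has more than `d+1` vertices. -/
def IsPure (Δ : SComplex) (d : ℕ) : Prop :=
  (∀ σ ∈ Δ.faces, σ.card ≤ d + 1) ∧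
  ∀ σ ∈ Δ.faces, ∃ τ ∈ Δ.faces, σ ⊆ τ ∧ τ.card = d + 1

/-- `σ` is a missing face of `Δ`: its boundary is in `Δ` but `σ` is not. -/
def IsMissing (Δ : SComplex) (σ : Finset ℕ) : Prop :=
  σ ∉ Δ.faces ∧ ∀ τ ⊂ σ, τ ∈ Δ.faces

/-- A pure `d`-dimensional complex is prime if it has no missing facets
(missing faces with `d+1` vertices). -/
def IsPrime (Δ : SComplex) (d : ℕ) : Prop :=
  ∀ σ : Finset ℕ, σ.card = d + 1 → ¬ Δ.IsMissing σ

/-- The faces of `Δ` with exactly `n` vertices. -/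
def facesOfCard (Δ : SComplex) (n : ℕ) : Finset (Finset ℕ) :=
  Δ.faces.filter fun σ => σ.card = n

/-- The matrix of the simplicial boundary map from chains spanned by faces with
`n+1` vertices to chains spanned by faces with `n` vertices, with the standard
signs coming from the natural order on the vertices. -/
def bdryMat (F : Type*) [Field F] (Δ : SComplex) (n : ℕ) :
    Matrix ↥(Δ.facesOfCard n) ↥(Δ.facesOfCard (n + 1)) F := fun τ σ =>
  if (τ : Finset ℕ) ⊆ (σ : Finset ℕ) then
    ∑ v ∈ (σ : Finset ℕ) \ (τ : Finset ℕ),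
      (-1 : F) ^ (((σ : Finset ℕ).filter fun x => x < v).card)
  else 0

/-- The simplicial boundary map (as a linear map) of the reduced simplicial chain
complex of `Δ` over `F`; chains in level `n` are spanned by the faces with `n`
vertices (so the empty face spans the level-0 part, giving the *reduced*
chain complex). -/
def bdry (F : Type*) [Field F] (Δ : SComplex) (n : ℕ) :
    (↥(Δ.facesOfCard (n + 1)) → F) →ₗ[F] ↥(Δ.facesOfCard n) → F :=
  (Δ.bdryMat F n).mulVecLin

/-- `betti F Δ n` is the reduced Betti number `b̃_{n-1}(Δ; F)`: the dimension of
the reduced simplicial homology of `Δ` over `F` in degree `n - 1` (chains in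
level `n` are spanned by the faces with `n` vertices). -/
def betti (F : Type*) [Field F] (Δ : SComplex) : ℕ → ℕ
  | 0 => (Δ.facesOfCard 0).card - Module.finrank F ↥(LinearMap.range (Δ.bdry F 0))
  | n + 1 =>
      Module.finrank F ↥(LinearMap.ker (Δ.bdry F n)) -
        Module.finrank F ↥(LinearMap.range (Δ.bdry F (n + 1)))

/-- `Δ` has the same reduced homology over `F` as the sphere `S^m`
(`m : ℤ`, possibly `-1`): all reduced Betti numbers vanish except in degree `m`,
where the Betti number is `1`. -/
def SameHomologyAsSphere (F : Type*) [Field F] (Δ : SComplex) (m : ℤ) : Prop :=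
  ∀ n : ℕ, (Δ.betti F n : ℤ) = if (n : ℤ) = m + 1 then 1 else 0

/-- `Δ` is an `F`-homology `d`-sphere: for every face `σ` (including the empty
face), the link of `σ` has the same reduced homology over `F` as the sphere of
dimension `d - |σ|`. -/
def IsHomologySphere (F : Type*) [Field F] (Δ : SComplex) (d : ℤ) : Prop :=
  Δ.faces.Nonempty ∧
  ∀ σ ∈ Δ.faces, (Δ.link σ).SameHomologyAsSphere F (d - (σ.card : ℤ))

/-- `Δ` is an `F`-homology `d`-manifold: it is pure of dimension `d` and the link
of every vertex is an `F`-homology `(d-1)`-sphere. -/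
def IsHomologyManifold (F : Type*) [Field F] (Δ : SComplex) (d : ℕ) : Prop :=
  Δ.IsPure d ∧ ∀ v ∈ Δ.vertexSet, (Δ.link {v}).IsHomologySphere F ((d : ℤ) - 1)

/-- The geometric realization of `Δ`: convex combinations of vertices supported
on faces of `Δ`, inside `ℕ → ℝ`. -/
def realization (Δ : SComplex) : Set (ℕ → ℝ) :=
  {f | ∃ σ ∈ Δ.faces, (∀ v, v ∉ σ → f v = 0) ∧ (∀ v, 0 ≤ f v) ∧ ∑ v ∈ σ, f v = 1}

/-- `Δ` is a triangulated `d`-sphere: its geometric realization is homeomorphic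
to the unit sphere in `ℝ^{d+1}`. -/
def IsTriangulatedSphere (Δ : SComplex) (d : ℕ) : Prop :=
  Nonempty (↥Δ.realization ≃ₜ ↥(Metric.sphere (0 : EuclideanSpace ℝ (Fin (d + 1))) 1))

/-- `Δ` is a triangulated `d`-ball: its geometric realization is homeomorphic
to the closed unit ball in `ℝ^d`. -/
def IsTriangulatedBall (Δ : SComplex) (d : ℕ) : Prop :=
  Nonempty (↥Δ.realization ≃ₜ ↥(Metric.closedBall (0 : EuclideanSpace ℝ (Fin d)) 1))

/-- Two vertices are related if they span an edge of `Δ`. -/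
def EdgeRel (Δ : SComplex) (x y : ℕ) : Prop :=
  x ≠ y ∧ ({x, y} : Finset ℕ) ∈ Δ.faces

/-- `Δ` is connected: it has a vertex, and any two vertices are joined by a path
of edges. -/
def IsConnectedC (Δ : SComplex) : Prop :=
  Δ.vertexSet.Nonempty ∧
  ∀ x ∈ Δ.vertexSet, ∀ y ∈ Δ.vertexSet, Relation.ReflTransGen Δ.EdgeRel x y

/-- Two facets of a pure `d`-complex are adjacent if they share a ridge. -/
def FacetAdj (Δ : SComplex) (d : ℕ) (σ τ : Finset ℕ) : Prop :=
  σ ∈ Δ.faces ∧ τ ∈ Δ.faces ∧ σ.card = d + 1 ∧ τ.card = d + 1 ∧ (σ ∩ τ).card = d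

/-- `Δ` is strongly connected: any two facets are joined by a chain of facets in
which consecutive facets share a ridge. -/
def StronglyConnected (Δ : SComplex) (d : ℕ) : Prop :=
  ∀ σ ∈ Δ.faces, ∀ τ ∈ Δ.faces, σ.card = d + 1 → τ.card = d + 1 →
    Relation.ReflTransGen (Δ.FacetAdj d) σ τ

/-- `Δ` is a normal `d`-pseudomanifold: pure, strongly connected, every
`(d-1)`-face lies in exactly two facets, and the link of every face of dimension
at most `d-2` is connected. -/
def IsNormalPseudomanifold (Δ : SComplex) (d : ℕ) : Prop :=
  Δ.IsPure d ∧ Δ.StronglyConnected d ∧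
  (∀ σ ∈ Δ.faces, σ.card = d →
    (Δ.faces.filter fun τ => σ ⊆ τ ∧ τ.card = d + 1).card = 2) ∧
  ∀ σ ∈ Δ.faces, σ.card + 1 ≤ d → IsConnectedC (Δ.link σ)

/-- The face set of the join of two (vertex-disjoint) complexes, given by their
face sets: all unions `σ ∪ τ`. -/
def joinFaces (A B : Finset (Finset ℕ)) : Finset (Finset ℕ) :=
  (A ×ˢ B).image fun p => p.1 ∪ p.2

/-- The face set of the boundary complex `∂σ` of a simplex `σ`:
all proper subsets of `σ`. -/
def bdryFaces (σ : Finset ℕ) : Finset (Finset ℕ) := σ.powerset.erase σ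

/-- `C` is an `n`-cycle: a connected pure 1-dimensional complex on `n ≥ 3`
vertices in which every vertex has exactly two neighbours. -/
def IsCycle (C : SComplex) (n : ℕ) : Prop :=
  3 ≤ n ∧ C.vertexSet.card = n ∧ C.IsPure 1 ∧ IsConnectedC C ∧
  ∀ v ∈ C.vertexSet, ((C.link {v}).vertexSet).card = 2

/-- The vertex set of the closed star of the vertex `u`. -/
def closedStarVerts (Δ : SComplex) (u : ℕ) : Finset ℕ :=
  insert u (Δ.link {u}).vertexSet

/-- The degree of a vertex: `d(u) = f₀(lk_Δ u)`. -/
def degree (Δ : SComplex) (u : ℕ) : ℕ := (Δ.link {u}).fVec 0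

/-- `Δ'` is obtained from `Δ` by a bistellar `i`-move in dimension `d`: for a
`(d-i)`-face `σ` with `lk_Δ σ = ∂τ`, where `τ` is an `i`-simplex not in `Δ`,
replace `σ ⋆ ∂τ` by `τ ⋆ ∂σ`. -/
def BistellarMove (d i : ℕ) (Δ Δ' : SComplex) : Prop :=
  ∃ σ τ : Finset ℕ, σ ∈ Δ.faces ∧ σ.card = d - i + 1 ∧ τ.card = i + 1 ∧
    τ ∉ Δ.faces ∧ (Δ.link σ).faces = bdryFaces τ ∧
    Δ'.faces = (Δ.faces.filter fun α => ¬ σ ⊆ α) ∪ joinFaces τ.powerset (bdryFaces σ)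

/-- `Δ'` is obtained from the `d`-dimensional complex `Δ` by contracting an edge
`uv` satisfying the link condition (with one of the two vertex links a
triangulated `(d-1)`-sphere), identifying `v` with `u`. -/
def EdgeContraction (d : ℕ) (Δ Δ' : SComplex) : Prop :=
  ∃ u v : ℕ, u ≠ v ∧ ({u, v} : Finset ℕ) ∈ Δ.faces ∧
    ((Δ.link {u}).IsTriangulatedSphere (d - 1) ∨
      (Δ.link {v}).IsTriangulatedSphere (d - 1)) ∧
    (Δ.link {u}).faces ∩ (Δ.link {v}).faces = (Δ.link ({u, v} : Finset ℕ)).faces ∧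
    Δ'.faces = Δ.faces.image fun σ => σ.image fun x => if x = v then u else x

/-- `Δ'` is obtained from the normal 4-pseudomanifold `Δ` by an edge expansion:
for a vertex `w` and a triangulated 2-sphere `S` separating `lk_Δ w` into a
triangulated 3-ball `D₁` and a complex `D₂` with common boundary `S`,
`Δ' = (Δ \ st_Δ w) ∪ (uv ⋆ S) ∪ (u ⋆ D₁) ∪ (v ⋆ D₂)` with `u`, `v` new
vertices. -/
def EdgeExpansion (Δ Δ' : SComplex) : Prop :=
  ∃ w u v : ℕ, ∃ S D₁ D₂ : SComplex,
    ({w} : Finset ℕ) ∈ Δ.faces ∧ u ≠ v ∧ u ∉ Δ.vertexSet ∧ v ∉ Δ.vertexSet ∧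
    S.IsTriangulatedSphere 2 ∧ D₁.IsTriangulatedBall 3 ∧
    D₁.faces ∪ D₂.faces = (Δ.link {w}).faces ∧
    D₁.faces ∩ D₂.faces = S.faces ∧
    Δ'.faces = (Δ.faces.filter fun σ => w ∉ σ) ∪
      joinFaces ({u, v} : Finset ℕ).powerset S.faces ∪
      joinFaces ({u} : Finset ℕ).powerset D₁.faces ∪
      joinFaces ({v} : Finset ℕ).powerset D₂.faces

/-- `Δ'` is obtained from the normal 4-pseudomanifold `Δ` by flipping an edge
`ab` with `lk_Δ ab = ∂(cd) ⋆ ∂(xyz)` (where `cd` is a missing edge of `Δ`) by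
`cd`: replace `ab ⋆ ∂(cd) ⋆ ∂(xyz)` by `∂(ab) ⋆ cd ⋆ ∂(xyz)`. -/
def EdgeFlip (Δ Δ' : SComplex) : Prop :=
  ∃ a b c d x y z : ℕ,
    ({a, b} : Finset ℕ).card = 2 ∧ ({c, d} : Finset ℕ).card = 2 ∧
    ({x, y, z} : Finset ℕ).card = 3 ∧
    ({a, b} : Finset ℕ) ∈ Δ.faces ∧ Δ.IsMissing {c, d} ∧
    (Δ.link ({a, b} : Finset ℕ)).faces =
      joinFaces (bdryFaces {c, d}) (bdryFaces {x, y, z}) ∧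
    Δ'.faces = (Δ.faces.filter fun α => ¬ ({a, b} : Finset ℕ) ⊆ α) ∪
      joinFaces (joinFaces (bdryFaces {a, b}) (({c, d} : Finset ℕ).powerset))
        (bdryFaces {x, y, z})

/-- Operation (i) on 4-dimensional complexes: `Δ` is obtained from `Δ'` by a
bistellar 1-move followed by an edge contraction. -/
def Op1 (Δ' Δ : SComplex) : Prop :=
  ∃ M : SComplex, BistellarMove 4 1 Δ' M ∧ EdgeContraction 4 M Δ

/-- Operation (ii) on 4-dimensional complexes: `Δ` is obtained from `Δ'` by an
edge expansion together with finitely many (possibly zero) edge flippings or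
bistellar 2-moves. -/
def Op2 (Δ' Δ : SComplex) : Prop :=
  ∃ M : SComplex, EdgeExpansion Δ' M ∧
    Relation.ReflTransGen (fun X Y => EdgeFlip X Y ∨ BistellarMove 4 2 X Y) M Δ

/-- Membership in the class `H_α`: prime `F`-homology 4-manifolds with
`g₂ = α` all of whose vertex links are prime. -/
def MemH (F : Type*) [Field F] (Δ : SComplex) (α : ℕ) : Prop :=
  Δ.IsHomologyManifold F 4 ∧ Δ.g2 4 = (α : ℤ) ∧ Δ.IsPrime 4 ∧
    ∀ v ∈ Δ.vertexSet, (Δ.link {v}).IsPrime 3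

/-- Property (*): whenever the link of a vertex `u` is `C ⋆ ∂(pqc)` for a cycle
`C` and a 2-simplex `pqc`, the triangle `pqc` is a face of `Δ` and every vertex
of `C` is incident to at least one diagonal edge (an edge of `Δ` joining two
vertices of `C` that are not adjacent in `C`). -/
def PropertyStar (Δ : SComplex) : Prop :=
  ∀ (u : ℕ) (C : SComplex) (p q c : ℕ) (n : ℕ),
    ({u} : Finset ℕ) ∈ Δ.faces → IsCycle C n → ({p, q, c} : Finset ℕ).card = 3 →
    (Δ.link {u}).faces = joinFaces C.faces (bdryFaces {p, q, c}) →
    ({p, q, c} : Finset ℕ) ∈ Δ.faces ∧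
      ∀ x ∈ C.vertexSet, ∃ y ∈ C.vertexSet,
        x ≠ y ∧ ({x, y} : Finset ℕ) ∉ C.faces ∧ ({x, y} : Finset ℕ) ∈ Δ.faces

/-- `Δ` is an octahedral 3-sphere:
`Δ = ∂(a₁b₁) ⋆ ∂(a₂b₂) ⋆ ∂(a₃b₃) ⋆ ∂(a₄b₄)`. -/
def IsOctahedral3Sphere (Δ : SComplex) : Prop :=
  ∃ a₁ b₁ a₂ b₂ a₃ b₃ a₄ b₄ : ℕ,
    ({a₁, b₁, a₂, b₂, a₃, b₃, a₄, b₄} : Finset ℕ).card = 8 ∧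
    Δ.faces = joinFaces (joinFaces (bdryFaces {a₁, b₁}) (bdryFaces {a₂, b₂}))
      (joinFaces (bdryFaces {a₃, b₃}) (bdryFaces {a₄, b₄}))

end SComplex
namespace SComplex

/-- Normal pseudomanifold without the strong connectivity clause. -/
def NP (K : SComplex) (d : ℕ) : Prop :=
  K.IsPure d ∧
  (∀ σ ∈ K.faces, σ.card = d →
    (K.faces.filter fun τ => σ ⊆ τ ∧ τ.card = d + 1).card = 2) ∧
  ∀ σ ∈ K.faces, σ.card + 1 ≤ d → IsConnectedC (K.link σ)

lemma mem_link {K : SComplex} {v : ℕ} {γ : Finset ℕ} :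
    γ ∈ (K.link {v}).faces ↔ v ∉ γ ∧ insert v γ ∈ K.faces := by
  simp only [link, Finset.mem_filter]
  have e : γ ∪ {v} = insert v γ := by ext; simp
  rw [e]
  constructor
  · rintro ⟨h1, h2, h3⟩
    refine ⟨fun h => ?_, h3⟩
    have : v ∈ γ ∩ {v} := by simp [h]
    rw [h2] at this; simp at this
  · rintro ⟨h1, h2⟩
    exact ⟨K.down _ h2 _ (Finset.subset_insert _ _), Finset.inter_singleton_of_notMem h1, h2⟩

lemma link_ext {K L : SComplex} (h : K.faces = L.faces) : K = L := by
  cases K; cases L; cases h; rfl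

lemma link_link {K : SComplex} {v : ℕ} {τ : Finset ℕ} (hv : v ∉ τ) :
    (K.link {v}).link τ = K.link (insert v τ) := by
  apply link_ext
  ext γ
  simp only [link, Finset.mem_filter]
  constructor
  · rintro ⟨⟨h1, h2, h3⟩, h4, h5, h6, h7⟩
    refine ⟨h1, ?_, ?_⟩
    · rw [Finset.insert_eq, Finset.inter_union_distrib_left, h2, h4]; rfl
    · convert h7 using 1; ext; simp
  · rintro ⟨h1, h2, h3⟩
    rw [Finset.insert_eq, Finset.inter_union_distrib_left, Finset.union_eq_empty] at h2
    have hd := K.down _ h3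
    refine ⟨⟨h1, h2.1, hd _ ?_⟩, h2.2, hd _ ?_, ?_, hd _ ?_⟩
    · intro x; simp; tauto
    · intro x; simp; tauto
    · rw [Finset.union_inter_distrib_right, h2.1]; rw [Finset.empty_union]; exact Finset.inter_singleton_of_notMem hv
    · intro x; simp

lemma mem_V {K : SComplex} {v : ℕ} : v ∈ K.vertexSet ↔ ({v} : Finset ℕ) ∈ K.faces := by
  simp only [vertexSet, Finset.mem_biUnion, id]
  constructor
  · rintro ⟨σ, h, hv⟩; exact K.down _ h _ (by simpa using hv)
  · intro h; exact ⟨_, h, by simp⟩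

lemma sub_V {K : SComplex} {σ : Finset ℕ} (h : σ ∈ K.faces) : σ ⊆ K.vertexSet := by
  intro x hx; exact mem_V.2 (K.down _ h _ (by simpa using hx))

lemma mem_V_link {K : SComplex} {u v : ℕ} :
    v ∈ (K.link {u}).vertexSet ↔ v ≠ u ∧ ({u, v} : Finset ℕ) ∈ K.faces := by
  rw [mem_V, mem_link]; simp [ne_comm]

lemma fVec_zero (K : SComplex) : K.fVec 0 = K.vertexSet.card := by
  unfold fVec
  have : K.faces.filter (fun σ => σ.card = 0 + 1) =
      K.vertexSet.image (fun v => ({v} : Finset ℕ)) := by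
    ext σ
    simp only [Finset.mem_filter, Finset.mem_image, zero_add, Finset.card_eq_one]
    constructor
    · rintro ⟨h, a, rfl⟩; exact ⟨a, mem_V.2 h, rfl⟩
    · rintro ⟨a, h, rfl⟩; exact ⟨mem_V.1 h, a, rfl⟩
  rw [this, Finset.card_image_of_injective _ Finset.singleton_injective]

lemma link_facets_card {K : SComplex} {v d : ℕ} {σ : Finset ℕ} (hv : v ∉ σ) :
    ((K.link {v}).faces.filter fun τ => σ ⊆ τ ∧ τ.card = d).card =
    (K.faces.filter fun τ => insert v σ ⊆ τ ∧ τ.card = d + 1).card := by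
  apply Finset.card_nbij' (fun τ => insert v τ) (fun τ => τ.erase v)
  · intro τ h
    simp only [Finset.coe_filter, Set.mem_ofPred_eq, mem_link] at h ⊢
    obtain ⟨⟨h1, h2⟩, h3, h4⟩ := h
    exact ⟨h2, Finset.insert_subset_insert _ h3, by rw [Finset.card_insert_of_notMem h1, h4]⟩
  · intro τ h
    simp only [Finset.coe_filter, Set.mem_ofPred_eq, mem_link] at h ⊢
    obtain ⟨h1, h2, h3⟩ := h
    have hm : v ∈ τ := h2 (by simp)
    refine ⟨⟨by simp, by rwa [Finset.insert_erase hm]⟩, ?_, ?_⟩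
    · intro x hx
      exact Finset.mem_erase.2 ⟨fun e => hv (e ▸ hx), h2 (by simp [hx])⟩
    · rw [Finset.card_erase_of_mem hm, h3]; rfl
  · intro τ h
    simp only [Finset.coe_filter, Set.mem_ofPred_eq, mem_link] at h
    exact Finset.erase_insert h.1.1
  · intro τ h
    simp only [Finset.coe_filter, Set.mem_ofPred_eq] at h
    exact Finset.insert_erase (h.2.1 (by simp))

lemma NP.link {K : SComplex} {d v : ℕ} (h : K.NP (d + 1)) : (K.link {v}).NP d := by
  obtain ⟨⟨hp1, hp2⟩, hr, hc⟩ := h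
  refine ⟨⟨?_, ?_⟩, ?_, ?_⟩
  · intro σ hσ
    rw [mem_link] at hσ
    have := hp1 _ hσ.2
    rw [Finset.card_insert_of_notMem hσ.1] at this
    omega
  · intro σ hσ
    rw [mem_link] at hσ
    obtain ⟨τ, h1, h2, h3⟩ := hp2 _ hσ.2
    have hm : v ∈ τ := h2 (by simp)
    refine ⟨τ.erase v, ?_, ?_, ?_⟩
    · rw [mem_link]; exact ⟨by simp, by rwa [Finset.insert_erase hm]⟩
    · intro x hx
      exact Finset.mem_erase.2 ⟨fun e => hσ.1 (e ▸ hx), h2 (by simp [hx])⟩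
    · rw [Finset.card_erase_of_mem hm, h3]; rfl
  · intro σ hσ hcard
    rw [mem_link] at hσ
    rw [link_facets_card hσ.1]
    exact hr _ hσ.2 (by rw [Finset.card_insert_of_notMem hσ.1, hcard])
  · intro σ hσ hcard
    rw [mem_link] at hσ
    rw [link_link hσ.1]
    exact hc _ hσ.2 (by rw [Finset.card_insert_of_notMem hσ.1]; omega)

lemma link_empty (K : SComplex) : K.link ∅ = K := by
  apply link_ext; ext; simp [SComplex.link]

lemma conn_cut {K : SComplex} (h : IsConnectedC K) (P : ℕ → Prop) {a b : ℕ}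
    (ha : a ∈ K.vertexSet) (hb : b ∈ K.vertexSet) (hPa : P a) (hPb : ¬ P b) :
    ∃ x y, P x ∧ ¬ P y ∧ x ≠ y ∧ ({x, y} : Finset ℕ) ∈ K.faces := by
  have hr := h.2 a ha b hb
  by_contra hcon
  push Not at hcon
  apply hPb
  clear hPb hb
  induction hr with
  | refl => exact hPa
  | tail _ h2 ih =>
    by_contra hn
    exact hcon _ _ ih hn h2.1 h2.2

lemma NP.conn {K : SComplex} {d : ℕ} (h : K.NP d) (hd : 1 ≤ d) (hne : K.faces.Nonempty) :
    IsConnectedC K := by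
  obtain ⟨σ, hσ⟩ := hne
  have := h.2.2 ∅ (K.down _ hσ _ (by simp)) (by simpa using hd)
  rwa [link_empty] at this

/-- number of edges meeting `W` -/
def eM (K : SComplex) (W : Finset ℕ) : Finset (Finset ℕ) :=
  K.faces.filter fun σ => σ.card = 2 ∧ (σ ∩ W).Nonempty

/-- edges inside `A` -/
def eIn (K : SComplex) (A : Finset ℕ) : Finset (Finset ℕ) :=
  K.faces.filter fun σ => σ.card = 2 ∧ σ ⊆ A

lemma mem_eM {K : SComplex} {W σ : Finset ℕ} :
    σ ∈ K.eM W ↔ σ ∈ K.faces ∧ σ.card = 2 ∧ (σ ∩ W).Nonempty := by simp [eM]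

lemma mem_eIn {K : SComplex} {W σ : Finset ℕ} :
    σ ∈ K.eIn W ↔ σ ∈ K.faces ∧ σ.card = 2 ∧ σ ⊆ W := by simp [eIn]

/-- The rigidity type count. -/
def LB (d : ℕ) : Prop := ∀ K : SComplex, K.NP d → ∀ F ∈ K.faces, F.card = d + 1 →
  ∀ W ⊆ K.vertexSet, Disjoint F W → (d + 1) * W.card ≤ (K.eM W).card

/-- edges of a vertex link plus cone edges. -/
lemma cone_count {K : SComplex} {x : ℕ} (W : Finset ℕ) (T : Finset (Finset ℕ))
    (hW : W ⊆ (K.link {x}).vertexSet)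
    (h1 : ∀ σ ∈ (K.link {x}).eM W, σ ∈ T)
    (h2 : ∀ w ∈ W, ({x, w} : Finset ℕ) ∈ T) :
    ((K.link {x}).eM W).card + W.card ≤ T.card := by
  classical
  have hinj : Set.InjOn (fun w => ({x, w} : Finset ℕ)) (W : Set ℕ) := by
    intro a ha b hb hab
    have ha' := (mem_V_link.1 (hW ha)).1
    have : a ∈ ({x, b} : Finset ℕ) := by
      have : a ∈ ({x, a} : Finset ℕ) := by simp
      simp only at hab
      rwa [hab] at this
    simp at this; tauto
  rw [← Finset.card_image_of_injOn hinj, ← Finset.card_union_of_disjoint]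
  · apply Finset.card_le_card
    intro σ hσ
    rw [Finset.mem_union, Finset.mem_image] at hσ
    rcases hσ with h | ⟨w, hw, rfl⟩
    · exact h1 _ h
    · exact h2 _ hw
  · rw [Finset.disjoint_left]
    intro σ h h'
    obtain ⟨w, hw, rfl⟩ := Finset.mem_image.1 h'
    have := (mem_link.1 (mem_eM.1 h).1).1
    simp at this

lemma LB_step {d : ℕ} (h : LB d) : LB (d + 1) := by
  intro K hK F hF hFc W hW hFW
  classical
  let Good : Finset ℕ → Prop := fun S => F ⊆ S ∧
    (∀ x ∈ S, ∃ G ∈ K.faces, G.card = d + 2 ∧ x ∈ G ∧ G ⊆ S) ∧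
    (d + 2) * (W ∩ S).card ≤ (K.eM W ∩ K.eIn S).card
  have hG0 : Good F := by
    refine ⟨subset_rfl, fun x hx => ⟨F, hF, hFc, hx, subset_rfl⟩, ?_⟩
    rw [Finset.inter_comm, Finset.disjoint_iff_inter_eq_empty.1 hFW]; simp
  obtain ⟨S, hS, hmax⟩ := Finset.exists_max_image (K.vertexSet.powerset.filter Good)
    Finset.card ⟨F, by simp [hG0, sub_V hF]⟩
  simp only [Finset.mem_filter, Finset.mem_powerset] at hS hmax
  obtain ⟨hSV, hFS, hfac, hcount⟩ := hS
  have hSeq : S = K.vertexSet := by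
    by_contra hne
    obtain ⟨b, hb, hbS⟩ := Finset.exists_of_ssubset (lt_of_le_of_ne hSV hne)
    obtain ⟨a, ha⟩ : F.Nonempty := by rw [← Finset.card_pos]; omega
    obtain ⟨x, y, hx, hy, hxy, hxyK⟩ := conn_cut (hK.conn (by omega) ⟨F, hF⟩)
      (fun v => v ∈ S) (sub_V hF ha) hb (hFS ha) hbS
    set L := (K.link {x}).vertexSet with hL
    have hyL : y ∈ L := mem_V_link.2 ⟨hxy.symm, hxyK⟩
    obtain ⟨G, hGK, hGc, hxG, hGS⟩ := hfac x hx
    set W' := (W ∩ L) \ S with hW'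
    have hcone : ((K.link {x}).eM W').card + W'.card ≤
        ((K.eM W ∩ K.eIn (S ∪ L)) \ (K.eM W ∩ K.eIn S)).card := by
      apply cone_count
      · intro w hw; simp [hW'] at hw; exact hw.1.2
      · intro σ hσ
        obtain ⟨h1, h2, w, hw⟩ := mem_eM.1 hσ
        simp only [hW', Finset.mem_inter, Finset.mem_sdiff] at hw
        have hσK : σ ∈ K.faces := K.down _ (mem_link.1 h1).2 _ (Finset.subset_insert _ _)
        simp only [Finset.mem_sdiff, Finset.mem_inter, mem_eM, mem_eIn]
        refine ⟨⟨⟨hσK, h2, w, by simp [hw]⟩, hσK, h2, ?_⟩, ?_⟩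
        · exact (sub_V h1).trans Finset.subset_union_right
        · rintro ⟨-, -, -, hs⟩; exact hw.2.2 (hs hw.1)
      · intro w hw
        simp only [hW', Finset.mem_inter, Finset.mem_sdiff] at hw
        obtain ⟨hwx, hwK⟩ := mem_V_link.1 hw.1.2
        have hc2 : ({x, w} : Finset ℕ).card = 2 := Finset.card_pair hwx.symm
        simp only [Finset.mem_sdiff, Finset.mem_inter, mem_eM, mem_eIn]
        refine ⟨⟨⟨hwK, hc2, w, by simp [hw]⟩, hwK, hc2, ?_⟩, ?_⟩
        · intro z hz; simp at hz; rcases hz with rfl | rfl <;> simp [hx, hw]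
        · rintro ⟨-, -, -, hs⟩; exact hw.2 (hs (by simp))
    have hlk := h (K.link {x}) hK.link (G.erase x)
      (mem_link.2 ⟨by simp, by rwa [Finset.insert_erase hxG]⟩)
      (by rw [Finset.card_erase_of_mem hxG, hGc]; rfl) W'
      (by intro w hw; simp [hW'] at hw; exact hw.1.2)
      (by
        rw [Finset.disjoint_left]; intro z hz hz'
        simp [hW'] at hz'
        exact hz'.2 (hGS (Finset.mem_of_mem_erase hz)))
    have hsub : K.eM W ∩ K.eIn S ⊆ K.eM W ∩ K.eIn (S ∪ L) := by
      intro σ hσ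
      simp only [Finset.mem_inter, mem_eIn] at hσ ⊢
      exact ⟨hσ.1, hσ.2.1, hσ.2.2.1, hσ.2.2.2.trans Finset.subset_union_left⟩
    rw [Finset.card_sdiff_of_subset hsub] at hcone
    have hle := Finset.card_le_card hsub
    have hWc : (W ∩ (S ∪ L)).card = (W ∩ S).card + W'.card := by
      rw [← Finset.card_union_of_disjoint]
      · congr 1; ext z; simp [hW']; tauto
      · rw [Finset.disjoint_left]; intro z; simp [hW']; tauto
    have hgood : Good (S ∪ L) := by
      refine ⟨hFS.trans Finset.subset_union_left, ?_, ?_⟩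
      · intro z hz
        rcases Finset.mem_union.1 hz with hz | hz
        · obtain ⟨G, a1, a2, a3, a4⟩ := hfac z hz
          exact ⟨G, a1, a2, a3, a4.trans Finset.subset_union_left⟩
        · obtain ⟨hzx, hzK⟩ := mem_V_link.1 hz
          obtain ⟨G, a1, a2, a3⟩ := hK.1.2 _ hzK
          refine ⟨G, a1, a3, a2 (by simp), ?_⟩
          intro t ht
          by_cases htx : t = x
          · subst htx; simp [hx]
          · apply Finset.mem_union_right
            refine mem_V_link.2 ⟨htx, K.down _ a1 _ ?_⟩
            intro s hs; simp at hs; rcases hs with rfl | rfl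
            · exact a2 (by simp)
            · exact ht
      · rw [hWc, mul_add]
        have : (d + 2) * W'.card = (d + 1) * W'.card + W'.card := by ring
        omega
    have := hmax (S ∪ L) ⟨Finset.union_subset hSV (by
      intro t ht
      exact mem_V.2 (K.down _ (mem_V_link.1 ht).2 _ (by simp))), hgood⟩
    have hlt : S.card < (S ∪ L).card := by
      apply Finset.card_lt_card
      exact ⟨Finset.subset_union_left, fun hh => hy (hh (by simp [hyL]))⟩
    omega
  rw [hSeq, Finset.inter_eq_left.2 hW] at hcount
  exact hcount.trans (Finset.card_le_card Finset.inter_subset_left)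

end SComplex

namespace SComplex

lemma parity1 {L : SComplex} (hL : L.NP 1) (W : Finset ℕ) :
    Even (L.faces.filter fun e => e.card = 2 ∧ (e ∩ W).card = 1).card := by
  classical
  have key := Finset.sum_card_bipartiteAbove_eq_sum_card_bipartiteBelow
    (s := W ∩ L.vertexSet) (t := L.faces.filter fun e => e.card = 2)
    (fun (w : ℕ) (e : Finset ℕ) => w ∈ e)
  have h1 : ∀ w ∈ W ∩ L.vertexSet,
      (Finset.bipartiteAbove (fun (w : ℕ) (e : Finset ℕ) => w ∈ e)
        (L.faces.filter fun e => e.card = 2) w).card = 2 := by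
    intro w hw
    have := hL.2.1 {w} (mem_V.1 (Finset.mem_inter.1 hw).2) (by simp)
    refine Eq.trans ?_ this
    congr 1
    ext e
    simp [Finset.bipartiteAbove]
    tauto
  have h2 : ∀ e ∈ L.faces.filter (fun e => e.card = 2),
      (Finset.bipartiteBelow (fun (w : ℕ) (e : Finset ℕ) => w ∈ e) (W ∩ L.vertexSet) e).card
        = (e ∩ W).card := by
    intro e he
    have hs := sub_V (Finset.mem_filter.1 he).1
    congr 1
    ext x
    simp only [Finset.bipartiteBelow, Finset.mem_filter, Finset.mem_inter]
    constructor
    · tauto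
    · rintro ⟨a, b⟩; exact ⟨⟨b, hs a⟩, a⟩
  rw [Finset.sum_congr rfl h1, Finset.sum_congr rfl h2] at key
  have hEven : Even (∑ e ∈ L.faces.filter (fun e => e.card = 2), (e ∩ W).card) := by
    rw [← key]; simp
  rw [Finset.even_sum_iff_even_card_odd] at hEven
  convert hEven using 2
  ext e
  simp only [Finset.mem_filter]
  constructor
  · rintro ⟨a, b, c⟩; exact ⟨⟨a, b⟩, by rw [c]; simp⟩
  · rintro ⟨⟨a, b⟩, c⟩
    refine ⟨a, b, ?_⟩
    have : (e ∩ W).card ≤ 2 := b ▸ Finset.card_le_card Finset.inter_subset_left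
    obtain ⟨k, hk⟩ := c
    omega

/-- triangles with exactly one vertex in `W` -/
def T1 (K : SComplex) (W : Finset ℕ) : Finset (Finset ℕ) :=
  K.faces.filter fun t => t.card = 3 ∧ (t ∩ W).card = 1

/-- triangles meeting `W` -/
def TM (K : SComplex) (W : Finset ℕ) : Finset (Finset ℕ) :=
  K.faces.filter fun t => t.card = 3 ∧ (t ∩ W).Nonempty

lemma cross_other {K : SComplex} (hK : K.NP 2) {W : Finset ℕ} {c d e w : ℕ}
    (hc : c ∉ W) (hd : d ∉ W) (he : e ∉ W) (hw : w ∈ W)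
    (hcd : c ≠ d) (hce : c ≠ e) (hde : d ≠ e)
    (h1 : ({c, d, e} : Finset ℕ) ∈ K.faces) (h2 : ({c, d, w} : Finset ℕ) ∈ K.faces) :
    ∃ t ∈ K.T1 W, c ∈ t ∧ d ∉ t := by
  classical
  have hcw : c ≠ w := fun h => hc (h ▸ hw)
  have hdw : d ≠ w := fun h => hd (h ▸ hw)
  have hew : e ≠ w := fun h => he (h ▸ hw)
  have hL : (K.link {c}).NP 1 := hK.link
  have hp := parity1 hL W
  set C := (K.link {c}).faces.filter fun e => e.card = 2 ∧ (e ∩ W).card = 1 with hC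
  have hm : ({d, w} : Finset ℕ) ∈ C := by
    simp only [hC, Finset.mem_filter, mem_link]
    refine ⟨⟨by simp [hcd, hcw], h2⟩, Finset.card_pair hdw, ?_⟩
    rw [Finset.insert_inter_of_notMem hd, Finset.singleton_inter_of_mem hw]; simp
  have h2le : 1 < C.card := by
    have := Finset.card_pos.2 ⟨_, hm⟩
    obtain ⟨k, hk⟩ := hp
    omega
  obtain ⟨s, hs, hne⟩ := Finset.exists_mem_ne h2le {d, w}
  simp only [hC, Finset.mem_filter, mem_link] at hs
  obtain ⟨⟨hs1, hs2⟩, hs3, hs4⟩ := hs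
  have hds : d ∉ s := by
    intro hds
    have hdL : ({d} : Finset ℕ) ∈ (K.link {c}).faces :=
      (K.link {c}).down _ (mem_link.2 ⟨hs1, hs2⟩) _ (by simpa using hds)
    have h3 := hL.2.1 {d} hdL (by simp)
    have hsub : ({{d, w}, {d, e}, s} : Finset (Finset ℕ)) ⊆
        (K.link {c}).faces.filter fun τ => {d} ⊆ τ ∧ τ.card = 1 + 1 := by
      intro τ hτ
      simp only [Finset.mem_insert, Finset.mem_singleton] at hτ
      simp only [Finset.mem_filter, mem_link]
      rcases hτ with rfl | rfl | rfl
      · exact ⟨⟨by simp [hcd, hcw], h2⟩, by simp, Finset.card_pair hdw⟩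
      · exact ⟨⟨by simp [hcd, hce], h1⟩, by simp, Finset.card_pair hde⟩
      · exact ⟨⟨hs1, hs2⟩, by simpa using hds, hs3⟩
    have hle := Finset.card_le_card hsub
    rw [h3] at hle
    have hw_ne : ({d, w} : Finset ℕ) ≠ {d, e} := by
      intro h
      have : w ∈ ({d, e} : Finset ℕ) := by rw [← h]; simp
      simp at this; rcases this with h | h
      · exact hdw h.symm
      · exact hew h.symm
    have hse : ({d, e} : Finset ℕ) ≠ s := by
      intro h
      rw [← h, Finset.insert_inter_of_notMem hd, Finset.singleton_inter_of_notMem he] at hs4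
      simp at hs4
    rw [Finset.card_eq_three.2 ⟨_, _, _, hw_ne, hne.symm, hse, rfl⟩] at hle
    omega
  refine ⟨insert c s, ?_, by simp, by simp [hds, hcd.symm]⟩
  simp only [T1, Finset.mem_filter]
  exact ⟨hs2, by rw [Finset.card_insert_of_notMem hs1, hs3],
    by rw [Finset.insert_inter_of_notMem hc, hs4]⟩

lemma three_le_T1 {K : SComplex} (hK : K.NP 2) {W F : Finset ℕ} (hF : F ∈ K.faces)
    (hFc : F.card = 3) (hFW : Disjoint F W) (hWV : W ⊆ K.vertexSet) (hW : W.Nonempty) :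
    3 ≤ (K.T1 W).card := by
  classical
  -- vertices in a triangle avoiding `W`
  obtain ⟨w0, hw0⟩ := hW
  obtain ⟨a, ha⟩ : F.Nonempty := by rw [← Finset.card_pos]; omega
  obtain ⟨x, y, ⟨G, hG, hGc, hGW, hxG⟩, hy, hxy, hxyK⟩ :=
    conn_cut (hK.conn (by omega) ⟨F, hF⟩)
      (fun v => ∃ G ∈ K.faces, G.card = 3 ∧ Disjoint G W ∧ v ∈ G) (sub_V hF ha) (hWV hw0)
      ⟨F, hF, hFc, hFW, ha⟩ (by
        rintro ⟨G, -, -, h3, h4⟩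
        exact Finset.disjoint_left.1 h3 h4 hw0)
  have hxW : x ∉ W := Finset.disjoint_left.1 hGW hxG
  obtain ⟨b, hb, hbx⟩ := Finset.exists_mem_ne (by omega : 1 < G.card) x
  have hbL : b ∈ (K.link {x}).vertexSet := mem_V_link.2 ⟨hbx, K.down _ hG _ (by
    intro s hs; simp at hs; rcases hs with rfl | rfl <;> assumption)⟩
  have hyL : y ∈ (K.link {x}).vertexSet := mem_V_link.2 ⟨hxy.symm, hxyK⟩
  obtain ⟨p, q, ⟨H, hH, hHc, hHW, hxH, hpH, hpx⟩, hq, hpq, hpqL⟩ :=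
    conn_cut (hK.2.2 {x} (K.down _ hG _ (by simpa using hxG)) (by simp))
      (fun v => ∃ G ∈ K.faces, G.card = 3 ∧ Disjoint G W ∧ x ∈ G ∧ v ∈ G ∧ v ≠ x) hbL hyL
      ⟨G, hG, hGc, hGW, hxG, hb, hbx⟩ (by
        rintro ⟨G', h1, h2, h3, h4, h5, h6⟩
        exact hy ⟨G', h1, h2, h3, h5⟩)
  obtain ⟨hxpq, hxpqK⟩ := mem_link.1 hpqL
  simp at hxpq
  have hpW : p ∉ W := Finset.disjoint_left.1 hHW hpH
  have hqW : q ∈ W := by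
    by_contra hqW
    apply hq
    refine ⟨{x, p, q}, hxpqK, Finset.card_eq_three.2 ⟨_, _, _, hxpq.1, hxpq.2, hpq, rfl⟩, ?_,
      by simp, by simp, fun h => hxpq.2 h.symm⟩
    rw [Finset.disjoint_left]; intro s hs
    simp at hs; rcases hs with rfl | rfl | rfl <;> assumption
  -- third vertex of `H`
  obtain ⟨r, hrH⟩ : ((H.erase x).erase p).Nonempty := by
    rw [← Finset.card_pos, Finset.card_erase_of_mem (by simp [hpx, hpH]),
      Finset.card_erase_of_mem hxH]; omega
  simp only [Finset.mem_erase] at hrH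
  obtain ⟨hrp, hrx, hrH⟩ := hrH
  have hrW : r ∉ W := Finset.disjoint_left.1 hHW hrH
  have hxprK : ({x, p, r} : Finset ℕ) ∈ K.faces := K.down _ hH _ (by
    intro s hs; simp at hs; rcases hs with rfl | rfl | rfl <;> assumption)
  obtain ⟨t1, ht1, h1a, h1b⟩ := cross_other hK hxW hpW hrW hqW hxpq.1 hrx.symm hrp.symm
    hxprK hxpqK
  obtain ⟨t2, ht2, h2a, h2b⟩ := cross_other hK hpW hxW hrW hqW hpx hrp.symm hrx.symm
    (by rwa [Finset.insert_comm]) (by rwa [Finset.insert_comm])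
  have ht0 : ({x, p, q} : Finset ℕ) ∈ K.T1 W := by
    simp only [T1, Finset.mem_filter]
    refine ⟨hxpqK, Finset.card_eq_three.2 ⟨_, _, _, hxpq.1, hxpq.2, hpq, rfl⟩, ?_⟩
    rw [Finset.insert_inter_of_notMem hxW, Finset.insert_inter_of_notMem hpW,
      Finset.singleton_inter_of_mem hqW]; simp
  rw [← Finset.card_eq_three.2 ⟨({x, p, q} : Finset ℕ), t1, t2, ?_, ?_, ?_, rfl⟩]
  · apply Finset.card_le_card
    intro s hs; simp at hs; rcases hs with rfl | rfl | rfl <;> assumption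
  · rintro rfl; simp at h1b
  · rintro rfl; simp at h2b
  · rintro rfl; exact h2b h1a

lemma double_count {K : SComplex} (hK : K.NP 2) (W : Finset ℕ) :
    2 * (K.eM W).card + (K.T1 W).card = 3 * (K.TM W).card := by
  classical
  have key := Finset.sum_card_bipartiteAbove_eq_sum_card_bipartiteBelow
    (s := K.eM W) (t := K.TM W) (fun (e t : Finset ℕ) => e ⊆ t)
  have h1 : ∀ e ∈ K.eM W,
      (Finset.bipartiteAbove (fun (e t : Finset ℕ) => e ⊆ t) (K.TM W) e).card = 2 := by
    intro e he
    obtain ⟨a, b, w, hw⟩ := mem_eM.1 he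
    rw [← hK.2.1 e a b]
    congr 1
    ext t
    simp only [Finset.bipartiteAbove, TM, Finset.mem_filter]
    constructor
    · tauto
    · rintro ⟨h1, h2, h3⟩
      refine ⟨⟨h1, h3, w, ?_⟩, h2⟩
      simp at hw ⊢; exact ⟨h2 hw.1, hw.2⟩
  have h2 : ∀ t ∈ K.TM W,
      (Finset.bipartiteBelow (fun (e t : Finset ℕ) => e ⊆ t) (K.eM W) t).card
        + (if (t ∩ W).card = 1 then 1 else 0) = 3 := by
    intro t ht
    simp only [TM, Finset.mem_filter] at ht
    obtain ⟨h1, h2, h3⟩ := ht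
    have e1 : Finset.bipartiteBelow (fun (e t : Finset ℕ) => e ⊆ t) (K.eM W) t =
        t.powersetCard 2 \ (t \ W).powersetCard 2 := by
      ext e
      simp only [Finset.bipartiteBelow, Finset.mem_filter, mem_eM, Finset.mem_sdiff,
        Finset.mem_powersetCard]
      constructor
      · rintro ⟨⟨a, b, w, hw⟩, c⟩
        refine ⟨⟨c, b⟩, fun h => ?_⟩
        simp at hw
        have := h.1 hw.1
        simp at this; exact this.2 hw.2
      · rintro ⟨⟨a, b⟩, c⟩
        refine ⟨⟨K.down _ h1 _ a, b, ?_⟩, a⟩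
        by_contra hn
        rw [Finset.not_nonempty_iff_eq_empty] at hn
        apply c
        refine ⟨fun x hx => ?_, b⟩
        rw [Finset.mem_sdiff]
        refine ⟨a hx, fun hxW => ?_⟩
        have : x ∈ e ∩ W := by simp [hx, hxW]
        rw [hn] at this; simp at this
    rw [e1, Finset.card_sdiff_of_subset (Finset.powersetCard_mono Finset.sdiff_subset),
      Finset.card_powersetCard, Finset.card_powersetCard, h2]
    have hs := Finset.card_sdiff_add_card_inter t W
    have hpos := Finset.card_pos.2 h3
    rw [h2] at hs
    have hchoose : Nat.choose 3 2 = 3 := by decide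
    rw [hchoose]
    split_ifs with h
    · have : (t \ W).card = 2 := by omega
      rw [this]; decide
    · have : (t \ W).card ≤ 1 := by omega
      rw [Nat.choose_eq_zero_of_lt (by omega)]
  rw [Finset.sum_congr rfl h1] at key
  have h3 := Finset.sum_congr rfl h2
  rw [Finset.sum_add_distrib, ← key, Finset.sum_boole] at h3
  have e2 : (K.TM W).filter (fun t => (t ∩ W).card = 1) = K.T1 W := by
    ext t
    simp only [TM, T1, Finset.mem_filter]
    constructor
    · tauto
    · rintro ⟨a, b, c⟩
      exact ⟨⟨a, b, Finset.card_pos.1 (by omega)⟩, c⟩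
  rw [e2] at h3
  simp at h3
  omega

end SComplex

namespace SComplex

lemma zmod2_add {a b : ZMod 2} (h : a + b = 0) : a = b := by
  revert a b; decide

/-- edges containing `w` inside a triangle `t` -/
lemma edges_at {K : SComplex} {W t : Finset ℕ} {w : ℕ} (ht : t ∈ K.faces) (hc : t.card = 3)
    (hw : w ∈ W) (hwt : w ∈ t) :
    ((K.eM W).filter fun e => w ∈ e ∧ e ⊆ t).card = 2 := by
  classical
  have e1 : (K.eM W).filter (fun e => w ∈ e ∧ e ⊆ t) =
      (t.erase w).image (fun a => ({w, a} : Finset ℕ)) := by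
    ext e
    simp only [Finset.mem_filter, mem_eM, Finset.mem_image, Finset.mem_erase]
    constructor
    · rintro ⟨⟨a, b, c⟩, h1, h2⟩
      obtain ⟨x, hx⟩ : (e.erase w).Nonempty := by
        rw [← Finset.card_pos, Finset.card_erase_of_mem h1]; omega
      simp at hx
      refine ⟨x, ⟨hx.1, h2 hx.2⟩, ?_⟩
      apply Finset.eq_of_subset_of_card_le
      · intro s hs; simp at hs; rcases hs with rfl | rfl
        · exact h1
        · exact hx.2
      · rw [b, Finset.card_pair (Ne.symm hx.1)]
    · rintro ⟨x, ⟨h1, h2⟩, rfl⟩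
      have hs : ({w, x} : Finset ℕ) ⊆ t := by
        intro s hs; simp at hs; rcases hs with rfl | rfl <;> assumption
      exact ⟨⟨K.down _ ht _ hs, Finset.card_pair h1.symm, w, by simp [hw]⟩, by simp, hs⟩
  rw [e1, Finset.card_image_of_injOn, Finset.card_erase_of_mem hwt, hc]
  intro a ha b hb hab
  simp only [Finset.coe_erase, Set.mem_sdiff, Set.mem_singleton_iff] at ha hb
  have : a ∈ ({w, b} : Finset ℕ) := by
    simp only at hab
    rw [← hab]; simp
  simp at this
  tauto

lemma euler_ineq {K : SComplex} (hK : K.NP 2) {W F : Finset ℕ} (hF : F ∈ K.faces)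
    (hFc : F.card = 3) (hFW : Disjoint F W) (hWV : W ⊆ K.vertexSet) (hW : W.Nonempty)
    (hconn : ∀ X ⊆ W, X.Nonempty → X ≠ W →
      ∃ x ∈ X, ∃ y ∈ W, y ∉ X ∧ ({x, y} : Finset ℕ) ∈ K.faces) :
    W.card + (K.TM W).card ≤ (K.eM W).card + 1 := by
  classical
  let M : Matrix (K.eM W) (K.TM W) (ZMod 2) := fun e t => if e.1 ⊆ t.1 then 1 else 0
  let N : Matrix W (K.eM W) (ZMod 2) := fun w e => if w.1 ∈ e.1 then 1 else 0
  have hNM : N * M = 0 := by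
    ext w t
    rw [Matrix.mul_apply]
    simp only [N, M, Matrix.zero_apply]
    rw [Finset.sum_coe_sort (K.eM W)
      (fun e => (if w.1 ∈ e then (1 : ZMod 2) else 0) * (if e ⊆ t.1 then 1 else 0))]
    have : ∀ e ∈ K.eM W, (if w.1 ∈ e then (1 : ZMod 2) else 0) * (if e ⊆ t.1 then 1 else 0)
        = if w.1 ∈ e ∧ e ⊆ t.1 then 1 else 0 := by
      intro e _; by_cases h1 : w.1 ∈ e <;> by_cases h2 : e ⊆ t.1 <;> simp [h1, h2]
    rw [Finset.sum_congr rfl this, Finset.sum_boole]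
    have ht := t.2
    simp only [TM, Finset.mem_filter] at ht
    by_cases hwt : w.1 ∈ t.1
    · rw [edges_at ht.1 ht.2.1 w.2 hwt]; decide
    · rw [Finset.filter_false_of_mem]
      · simp
      · rintro e _ ⟨h1, h2⟩; exact hwt (h2 h1)
  have hrank := Matrix.rank_add_rank_le_card_of_mul_eq_zero hNM
  rw [Fintype.card_coe] at hrank
  have hN : N.rank = W.card := by
    rw [← Matrix.rank_transpose, Matrix.rank, LinearMap.finrank_range_of_inj]
    · simp
    · rw [← LinearMap.ker_eq_bot, LinearMap.ker_eq_bot']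
      intro x hx
      let y : ℕ → ZMod 2 := fun v => if h : v ∈ W then x ⟨v, h⟩ else 0
      have hy0 : ∀ v, v ∉ W → y v = 0 := fun v hv => by simp [y, hv]
      have hye : ∀ a b, a ≠ b → ({a, b} : Finset ℕ) ∈ K.faces → a ∈ W → y a = y b := by
        intro a b hab hK' ha
        have hmem : ({a, b} : Finset ℕ) ∈ K.eM W :=
          mem_eM.2 ⟨hK', Finset.card_pair hab, a, by simp [ha]⟩
        have h1 := congrFun hx ⟨_, hmem⟩
        replace h1 : ∑ w : W, (if w.1 ∈ ({a, b} : Finset ℕ) then (1 : ZMod 2) else 0) * x w = 0 :=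
          h1
        have h2 : ∀ w : W, (if w.1 ∈ ({a, b} : Finset ℕ) then (1 : ZMod 2) else 0) * x w =
            if w.1 ∈ ({a, b} : Finset ℕ) then y w.1 else 0 := by
          intro w; simp [y]
        rw [Finset.sum_congr rfl (fun w _ => h2 w),
          Finset.sum_coe_sort W (fun w => if w ∈ ({a, b} : Finset ℕ) then y w else 0),
          ← Finset.sum_filter] at h1
        have h3 : ∑ v ∈ ({a, b} : Finset ℕ), y v = 0 := by
          rw [← h1]
          symm
          apply Finset.sum_subset
          · intro v hv; exact (Finset.mem_filter.1 hv).2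
          · intro v hv hv'
            apply hy0; intro hvW; exact hv' (Finset.mem_filter.2 ⟨hvW, hv⟩)
        rw [Finset.sum_pair hab] at h3
        exact zmod2_add h3
      by_contra hne
      obtain ⟨w, hw⟩ := Function.ne_iff.1 hne
      obtain ⟨a, ha⟩ : F.Nonempty := by rw [← Finset.card_pos]; omega
      obtain ⟨p, q, hp, hq, hpq, hpqK⟩ := conn_cut (hK.conn (by omega) ⟨F, hF⟩)
        (fun v => y v ≠ 0) (hWV w.2) (sub_V hF ha)
        (by simpa [y] using hw) (by
          simp only [not_not]; exact hy0 _ (Finset.disjoint_left.1 hFW ha))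
      have hpW : p ∈ W := by by_contra h; exact hp (hy0 _ h)
      apply hp
      rw [hye p q hpq hpqK hpW]
      simpa using hq
  have hM : (K.TM W).card ≤ M.rank + 1 := by
    have h1 := LinearMap.finrank_range_add_finrank_ker M.mulVecLin
    have h2 : Module.finrank (ZMod 2) (K.TM W → ZMod 2) = (K.TM W).card := by simp
    rw [h2] at h1
    have h3 : Module.finrank (ZMod 2) (LinearMap.ker M.mulVecLin) ≤ 1 := by
      have hle : LinearMap.ker M.mulVecLin ≤
          Submodule.span (ZMod 2) {(fun _ => 1 : K.TM W → ZMod 2)} := by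
        intro z hz
        rw [LinearMap.mem_ker] at hz
        let y : Finset ℕ → ZMod 2 := fun t => if h : t ∈ K.TM W then z ⟨t, h⟩ else 0
        have hadj : ∀ e ∈ K.eM W, ∀ s ∈ K.faces, ∀ t ∈ K.faces, s.card = 3 → t.card = 3 →
            e ⊆ s → e ⊆ t → y s = y t := by
          intro e he s hs t ht hsc htc hes het
          by_cases hst : s = t
          · rw [hst]
          have h1 := congrFun hz ⟨e, he⟩
          rw [Matrix.mulVecLin_apply, Matrix.mulVec, dotProduct] at h1
          simp only [M, Pi.zero_apply] at h1
          have h2 : ∀ r : K.TM W, (if e ⊆ r.1 then (1 : ZMod 2) else 0) * z r =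
              if e ⊆ r.1 then y r.1 else 0 := by
            intro r; simp [y]
          rw [Finset.sum_congr rfl (fun w _ => h2 w),
            Finset.sum_coe_sort (K.TM W) (fun r => if e ⊆ r then y r else 0),
            ← Finset.sum_filter] at h1
          obtain ⟨a, b, w, hw⟩ := mem_eM.1 he
          simp only [Finset.mem_inter] at hw
          have hcard := hK.2.1 e a b
          have h4 : (K.TM W).filter (fun r => e ⊆ r) = {s, t} := by
            symm
            apply Finset.eq_of_subset_of_card_le
            · intro r hr
              simp only [Finset.mem_insert, Finset.mem_singleton] at hr
              simp only [TM, Finset.mem_filter]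
              rcases hr with rfl | rfl
              · exact ⟨⟨hs, hsc, w, by simp [hw, hes hw.1]⟩, hes⟩
              · exact ⟨⟨ht, htc, w, by simp [hw, het hw.1]⟩, het⟩
            · rw [Finset.card_pair hst, ← hcard]
              apply Finset.card_le_card
              intro r hr
              simp only [TM, Finset.mem_filter] at hr ⊢
              tauto
          rw [h4, Finset.sum_pair hst] at h1
          exact zmod2_add h1
        have hpair : ∀ w ∈ W, ∀ x, x ≠ w → ({w, x} : Finset ℕ) ∈ K.faces →
            ∀ s ∈ K.faces, ∀ t ∈ K.faces, s.card = 3 → t.card = 3 →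
            w ∈ s → x ∈ s → w ∈ t → x ∈ t → y s = y t := by
          intro w hw x hxw hxK s hs t ht hsc htc h1 h2 h3 h4
          refine hadj {w, x} (mem_eM.2 ⟨hxK, Finset.card_pair hxw.symm, w, by simp [hw]⟩)
            s hs t ht hsc htc ?_ ?_
          · intro r hr; simp at hr; rcases hr with rfl | rfl <;> assumption
          · intro r hr; simp at hr; rcases hr with rfl | rfl <;> assumption
        have hstar : ∀ w ∈ W, ∀ s ∈ K.faces, ∀ t ∈ K.faces, s.card = 3 → t.card = 3 →
            w ∈ s → w ∈ t → y s = y t := by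
          intro w hw s hs t ht hsc htc hws hwt
          by_contra hne
          obtain ⟨a, ha, haw⟩ := Finset.exists_mem_ne (by omega : 1 < t.card) w
          obtain ⟨b, hb, hbw⟩ := Finset.exists_mem_ne (by omega : 1 < s.card) w
          have haK : ({w, a} : Finset ℕ) ∈ K.faces := K.down _ ht _ (by
            intro r hr; simp at hr; rcases hr with rfl | rfl <;> assumption)
          have hbK : ({w, b} : Finset ℕ) ∈ K.faces := K.down _ hs _ (by
            intro r hr; simp at hr; rcases hr with rfl | rfl <;> assumption)
          obtain ⟨p, q, hp, hq, hpq, hpqL⟩ :=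
            conn_cut (hK.2.2 {w} (mem_V.1 (hWV hw)) (by simp))
            (fun v => ∀ r ∈ K.faces, r.card = 3 → w ∈ r → v ∈ r → y r = y t)
            (mem_V_link.2 ⟨haw, haK⟩) (mem_V_link.2 ⟨hbw, hbK⟩)
            (fun r hr hrc h1 h2 => hpair w hw a haw haK r hr t ht hrc htc h1 h2 hwt ha)
            (fun h => hne (h s hs hsc hws hb))
          obtain ⟨hwpq, hwpqK⟩ := mem_link.1 hpqL
          simp at hwpq
          have hc3 : ({w, p, q} : Finset ℕ).card = 3 :=
            Finset.card_eq_three.2 ⟨_, _, _, hwpq.1, hwpq.2, hpq, rfl⟩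
          apply hq
          intro r hr hrc h1 h2
          rw [← hp _ hwpqK hc3 (by simp) (by simp)]
          refine hpair w hw q (fun h => hwpq.2 h.symm) (K.down _ hr _ ?_) r hr _ hwpqK hrc hc3
            h1 h2 (by simp) (by simp)
          intro r' hr'; simp at hr'; rcases hr' with rfl | rfl <;> assumption
        obtain ⟨w0, hw0⟩ := hW
        obtain ⟨t0, ht0, ht0s, ht0c⟩ := hK.1.2 _ (mem_V.1 (hWV hw0))
        have hw0t : w0 ∈ t0 := ht0s (by simp)
        let X := W.filter fun w => ∀ s ∈ K.faces, s.card = 3 → w ∈ s → y s = y t0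
        have hXW : X = W := by
          by_contra hne
          obtain ⟨a, ha, b, hb, hbX, habK⟩ := hconn X (Finset.filter_subset _ _)
            ⟨w0, Finset.mem_filter.2 ⟨hw0, fun s hs hsc hws =>
              hstar w0 hw0 s hs t0 ht0 hsc ht0c hws hw0t⟩⟩ hne
          obtain ⟨s, hs, hss, hsc⟩ := hK.1.2 _ habK
          apply hbX
          refine Finset.mem_filter.2 ⟨hb, fun r hr hrc hbr => ?_⟩
          rw [hstar b hb r hr s hs hrc hsc hbr (hss (by simp))]
          exact (Finset.mem_filter.1 ha).2 s hs hsc (hss (by simp))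
        rw [Submodule.mem_span_singleton]
        refine ⟨y t0, ?_⟩
        ext t
        have ht := t.2
        simp only [TM, Finset.mem_filter] at ht
        obtain ⟨h1, h2, w, hw⟩ := ht
        simp only [Finset.mem_inter] at hw
        have hwX : w ∈ X := by rw [hXW]; exact hw.2
        have := (Finset.mem_filter.1 hwX).2 t.1 h1 h2 hw.1
        simp only [Pi.smul_apply, smul_eq_mul, mul_one]
        rw [← this]
        simp [y]
      refine (Submodule.finrank_mono hle).trans ?_
      refine (finrank_span_le_card _).trans ?_
      simp
    rw [Matrix.rank]
    omega
  omega

lemma LB_two : LB 2 := by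
  intro K hK F hF hFc W
  induction W using Finset.strongInduction with
  | _ W ih =>
  intro hWV hFW
  classical
  rcases W.eq_empty_or_nonempty with rfl | hW
  · simp
  by_cases hconn : ∀ X ⊆ W, X.Nonempty → X ≠ W →
      ∃ x ∈ X, ∃ y ∈ W, y ∉ X ∧ ({x, y} : Finset ℕ) ∈ K.faces
  · have h1 := euler_ineq hK hF hFc hFW hWV hW hconn
    have h2 := double_count hK W
    have h3 := three_le_T1 hK hF hFc hFW hWV hW
    omega
  · push Not at hconn
    obtain ⟨X, hXW, hX, hne, hcut⟩ := hconn
    have hss : X ⊂ W := lt_of_le_of_ne hXW hne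
    have i1 := ih X hss (hXW.trans hWV) (hFW.mono_right hXW)
    have hss2 : W \ X ⊂ W := Finset.sdiff_ssubset hXW hX
    have i2 := ih (W \ X) hss2 (hss2.1.trans hWV) (hFW.mono_right hss2.1)
    have hc := Finset.card_sdiff_add_card_eq_card hXW
    have hdisj : Disjoint (K.eM X) (K.eM (W \ X)) := by
      rw [Finset.disjoint_left]
      intro e he he'
      obtain ⟨h1, h2, a, ha⟩ := mem_eM.1 he
      obtain ⟨-, -, b, hb⟩ := mem_eM.1 he'
      simp only [Finset.mem_inter, Finset.mem_sdiff] at ha hb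
      refine hcut a ha.2 b hb.2.1 hb.2.2 (K.down _ h1 _ ?_)
      intro r hr; simp at hr; rcases hr with rfl | rfl
      · exact ha.1
      · exact hb.1
    have hle : (K.eM X ∪ K.eM (W \ X)).card ≤ (K.eM W).card := by
      apply Finset.card_le_card
      intro e he
      rcases Finset.mem_union.1 he with he | he
      · obtain ⟨h1, h2, a, ha⟩ := mem_eM.1 he
        exact mem_eM.2 ⟨h1, h2, a, by simp at ha ⊢; exact ⟨ha.1, hXW ha.2⟩⟩
      · obtain ⟨h1, h2, a, ha⟩ := mem_eM.1 he
        exact mem_eM.2 ⟨h1, h2, a, by simp at ha ⊢; exact ⟨ha.1, ha.2.1⟩⟩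
    rw [Finset.card_union_of_disjoint hdisj] at hle
    rw [← hc]
    omega

lemma LB_all (d : ℕ) (hd : 2 ≤ d) : LB d := by
  induction d, hd using Nat.le_induction with
  | base => exact LB_two
  | succ n _ ih => exact LB_step ih

end SComplex

namespace SComplex

lemma choose_succ_two (d : ℕ) : Nat.choose (d + 1) 2 = Nat.choose d 2 + d := by
  rw [Nat.choose_succ_succ' d 1]; simp [add_comm]

lemma two_choose (d : ℕ) : 2 * (Nat.choose (d + 1) 2 : ℤ) = (d + 1) * d := by
  induction d with
  | zero => simp
  | succ n ih => rw [choose_succ_two (n + 1)]; push_cast; linarith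

lemma two_choose' (d : ℕ) : 2 * (Nat.choose (d + 2) 2 : ℤ) = (d + 2) * (d + 1) := by
  have := two_choose (d + 1); push_cast at this; linarith

lemma fVec_one_split (K : SComplex) (A : Finset ℕ) :
    K.fVec 1 = (K.eIn A).card + (K.eM (K.vertexSet \ A)).card := by
  classical
  rw [← Finset.card_union_of_disjoint]
  · unfold fVec
    congr 1
    ext e
    simp only [Finset.mem_filter, Finset.mem_union, mem_eIn, mem_eM]
    constructor
    · rintro ⟨h1, h2⟩
      by_cases h : e ⊆ A
      · exact Or.inl ⟨h1, h2, h⟩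
      · right
        obtain ⟨x, hx, hxA⟩ := Finset.not_subset.1 h
        exact ⟨h1, h2, x, by simp [hx, hxA, sub_V h1 hx]⟩
    · rintro (h | h) <;> exact ⟨h.1, h.2.1⟩
  · rw [Finset.disjoint_left]
    intro e h1 h2
    obtain ⟨-, -, x, hx⟩ := mem_eM.1 h2
    simp at hx
    exact hx.2.2 ((mem_eIn.1 h1).2.2 hx.1)

lemma g2_sub {K : SComplex} {d : ℕ} (hd : 2 ≤ d) (hK : K.NP d) {F A : Finset ℕ}
    (hF : F ∈ K.faces) (hFc : F.card = d + 1) (hFA : F ⊆ A) (hA : A ⊆ K.vertexSet) :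
    ((K.eIn A).card : ℤ) - (d + 1) * A.card + (Nat.choose (d + 2) 2 : ℤ) ≤ K.g2 d := by
  have h1 := LB_all d hd K hK F hF hFc (K.vertexSet \ A) Finset.sdiff_subset (by
    rw [Finset.disjoint_left]; intro x hx; simp [hFA hx])
  have h2 := fVec_one_split K A
  have h3 := Finset.card_sdiff_add_card_eq_card hA
  unfold g2
  rw [fVec_zero, h2, ← h3]
  zify at h1
  push_cast
  nlinarith

lemma g2_nonneg {K : SComplex} {d : ℕ} (hd : 2 ≤ d) (hK : K.NP d) (hne : K.faces.Nonempty) :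
    0 ≤ K.g2 d := by
  obtain ⟨σ, hσ⟩ := hne
  obtain ⟨F, hF, -, hFc⟩ := hK.1.2 σ hσ
  have h := g2_sub hd hK hF hFc subset_rfl (sub_V hF)
  have h1 : K.eIn F = F.powersetCard 2 := by
    ext e
    simp only [mem_eIn, Finset.mem_powersetCard]
    exact ⟨fun h => ⟨h.2.2, h.2.1⟩, fun h => ⟨K.down _ hF _ h.1, h.2, h.1⟩⟩
  rw [h1, Finset.card_powersetCard, hFc] at h
  have h2 := two_choose d
  have h3 := two_choose' d
  push_cast at h
  nlinarith

/-- closed star vertices -/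
def cs (K : SComplex) (u : ℕ) : Finset ℕ := insert u (K.link {u}).vertexSet

lemma cs_card (K : SComplex) (u : ℕ) : (K.cs u).card = (K.link {u}).vertexSet.card + 1 := by
  apply Finset.card_insert_of_notMem
  intro h; exact (mem_V_link.1 h).1 rfl

lemma cs_sub {K : SComplex} {u : ℕ} (hu : {u} ∈ K.faces) : K.cs u ⊆ K.vertexSet := by
  intro x hx
  rcases Finset.mem_insert.1 hx with rfl | hx
  · exact mem_V.2 hu
  · exact mem_V.2 (K.down _ (mem_V_link.1 hx).2 _ (by simp))

lemma facet_sub_cs {K : SComplex} {u : ℕ} {F : Finset ℕ} (hF : F ∈ K.faces) (hu : u ∈ F) :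
    F ⊆ K.cs u := by
  intro x hx
  by_cases h : x = u
  · subst h; exact Finset.mem_insert_self _ _
  · refine Finset.mem_insert_of_mem (mem_V_link.2 ⟨h, K.down _ hF _ ?_⟩)
    intro r hr; simp at hr; rcases hr with rfl | rfl <;> assumption

lemma fVec_one_eq_eM (K : SComplex) : K.fVec 1 = (K.eM K.vertexSet).card := by
  unfold fVec
  congr 1
  ext e
  simp only [Finset.mem_filter, mem_eM]
  constructor
  · rintro ⟨h1, h2⟩
    refine ⟨h1, h2, ?_⟩
    rw [Finset.inter_eq_left.2 (sub_V h1), ← Finset.card_pos]; omega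
  · tauto

lemma star_count {K : SComplex} (u : ℕ) (T : Finset (Finset ℕ))
    (h1 : ∀ σ ∈ (K.link {u}).faces, σ.card = 2 → σ ∈ T)
    (h2 : ∀ w ∈ (K.link {u}).vertexSet, ({u, w} : Finset ℕ) ∈ T) :
    (K.link {u}).fVec 1 + (K.link {u}).fVec 0 ≤ T.card := by
  rw [fVec_one_eq_eM, fVec_zero]
  exact cone_count _ T subset_rfl (fun σ hσ => h1 _ (mem_eM.1 hσ).1 (mem_eM.1 hσ).2.1) h2

lemma link_edge_mem {K : SComplex} {u : ℕ} {σ : Finset ℕ} (h : σ ∈ (K.link {u}).faces)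
    (hc : σ.card = 2) : σ ∈ K.eIn (K.cs u) :=
  mem_eIn.2 ⟨K.down _ (mem_link.1 h).2 _ (Finset.subset_insert _ _), hc,
    (sub_V h).trans (Finset.subset_insert _ _)⟩

lemma cone_edge_mem {K : SComplex} {u w : ℕ} (h : w ∈ (K.link {u}).vertexSet) :
    ({u, w} : Finset ℕ) ∈ K.eIn (K.cs u) := by
  obtain ⟨h1, h2⟩ := mem_V_link.1 h
  refine mem_eIn.2 ⟨h2, Finset.card_pair h1.symm, ?_⟩
  intro r hr; simp at hr; rcases hr with rfl | rfl
  · exact Finset.mem_insert_self _ _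
  · exact Finset.mem_insert_of_mem h

lemma star_in (K : SComplex) (u : ℕ) :
    (K.link {u}).fVec 1 + (K.link {u}).fVec 0 ≤ (K.eIn (K.cs u)).card :=
  star_count u _ (fun _ h hc => link_edge_mem h hc) (fun _ h => cone_edge_mem h)

lemma link_ne {K : SComplex} {u : ℕ} (hu : {u} ∈ K.faces) : (K.link {u}).faces.Nonempty :=
  ⟨∅, mem_link.2 ⟨by simp, by simpa using hu⟩⟩

/-- lower bound for edges in a star. -/
lemma star_lb {K : SComplex} {d u : ℕ} (hd : 2 ≤ d) (hK : K.NP (d + 1)) (hu : {u} ∈ K.faces) :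
    ((d : ℤ) + 2) * (K.cs u).card - (Nat.choose (d + 3) 2 : ℤ) ≤ (K.eIn (K.cs u)).card := by
  have h1 := g2_nonneg hd (hK.link (v := u)) (link_ne hu)
  have h2 := star_in K u
  unfold g2 at h1
  rw [cs_card, ← fVec_zero]
  have h3 := choose_succ_two (d + 2)
  zify at h2
  rw [h3]; push_cast
  nlinarith

lemma g2_link_le {K : SComplex} {d u : ℕ} (hd : 2 ≤ d) (hK : K.NP (d + 1))
    (hu : {u} ∈ K.faces) : (K.link {u}).g2 d ≤ K.g2 (d + 1) := by
  obtain ⟨F, hF, hs, hFc⟩ := hK.1.2 _ hu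
  have h1 := g2_sub (by omega) hK hF hFc (facet_sub_cs hF (hs (by simp))) (cs_sub hu)
  have h2 := star_in K u
  rw [cs_card, ← fVec_zero] at h1
  have h3 := choose_succ_two (d + 2)
  have e : d + 1 + 2 = d + 2 + 1 := by ring
  rw [e, h3] at h1
  unfold g2 at h1 ⊢
  push_cast at h1 ⊢
  zify at h2
  rw [e, h3] 
  push_cast
  nlinarith

lemma no_missing_tri {K : SComplex} {d u a b : ℕ} (hd : 2 ≤ d) (hK : K.NP (d + 1))
    (hg : K.g2 (d + 1) ≤ 0) (hua : u ≠ a) (hub : u ≠ b) (hab : a ≠ b)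
    (h1 : ({u, a} : Finset ℕ) ∈ K.faces) (h2 : ({u, b} : Finset ℕ) ∈ K.faces)
    (h3 : ({a, b} : Finset ℕ) ∈ K.faces) : ({u, a, b} : Finset ℕ) ∈ K.faces := by
  classical
  by_contra hcon
  have hu : {u} ∈ K.faces := K.down _ h1 _ (by simp)
  have ha : a ∈ (K.link {u}).vertexSet := mem_V_link.2 ⟨hua.symm, h1⟩
  have hb : b ∈ (K.link {u}).vertexSet := mem_V_link.2 ⟨hub.symm, h2⟩
  obtain ⟨F, hF, hs, hFc⟩ := hK.1.2 _ hu
  have k1 := g2_sub (by omega) hK hF hFc (facet_sub_cs hF (hs (by simp))) (cs_sub hu)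
  have hmem : ({a, b} : Finset ℕ) ∈ K.eIn (K.cs u) := by
    refine mem_eIn.2 ⟨h3, Finset.card_pair hab, ?_⟩
    intro r hr; simp at hr; rcases hr with rfl | rfl <;> exact Finset.mem_insert_of_mem ‹_›
  have k2 := star_count u ((K.eIn (K.cs u)).erase {a, b})
    (fun σ h hc => Finset.mem_erase.2 ⟨by
      rintro rfl; exact hcon (mem_link.1 h).2, link_edge_mem h hc⟩)
    (fun w h => Finset.mem_erase.2 ⟨by
      intro e
      have : u ∈ ({a, b} : Finset ℕ) := by rw [← e]; simp
      simp at this; tauto, cone_edge_mem h⟩)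
  have k3 := Finset.card_erase_add_one hmem
  have k4 := g2_nonneg hd (hK.link (v := u)) (link_ne hu)
  rw [cs_card, ← fVec_zero, ← k3] at k1
  have e := choose_succ_two (d + 2)
  have e' : d + 1 + 2 = d + 2 + 1 := by ring
  rw [e', e] at k1
  unfold g2 at k4
  push_cast at k1 k4
  zify at k2
  nlinarith

lemma no_missing (d : ℕ) (hd : 2 ≤ d) : ∀ K : SComplex, K.NP (d + 1) → K.g2 (d + 1) ≤ 0 →
    ∀ τ : Finset ℕ, 3 ≤ τ.card → τ.card ≤ d + 1 → (∀ ρ ⊂ τ, ρ ∈ K.faces) → τ ∈ K.faces := by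
  have tri : ∀ d, 2 ≤ d → ∀ K : SComplex, K.NP (d + 1) → K.g2 (d + 1) ≤ 0 →
      ∀ τ : Finset ℕ, τ.card = 3 → (∀ ρ ⊂ τ, ρ ∈ K.faces) → τ ∈ K.faces := by
    intro d hd K hK hg τ hτ h
    obtain ⟨a, b, c, hab, hac, hbc, rfl⟩ := Finset.card_eq_three.1 hτ
    have hp : ∀ x y, x ≠ y → x ∈ ({a, b, c} : Finset ℕ) → y ∈ ({a, b, c} : Finset ℕ) →
        ({x, y} : Finset ℕ) ∈ K.faces := by
      intro x y hxy hx hy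
      apply h
      refine lt_of_le_of_ne ?_ ?_
      · intro r hr; rw [Finset.mem_insert, Finset.mem_singleton] at hr
        rcases hr with rfl | rfl <;> assumption
      · intro e; rw [← e, Finset.card_pair hxy] at hτ; omega
    exact no_missing_tri hd hK hg hab hac hbc (hp _ _ hab (by simp) (by simp))
      (hp _ _ hac (by simp) (by simp)) (hp _ _ hbc (by simp) (by simp))
  induction d, hd using Nat.le_induction with
  | base =>
    intro K hK hg τ h1 h2 h
    exact tri 2 le_rfl K hK hg τ (by omega) h
  | succ n hn ih =>
    intro K hK hg τ h1 h2 h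
    by_cases h3 : τ.card = 3
    · exact tri (n + 1) (by omega) K hK hg τ h3 h
    obtain ⟨u, hu⟩ : τ.Nonempty := by rw [← Finset.card_pos]; omega
    have huK : {u} ∈ K.faces := by
      apply h
      refine lt_of_le_of_ne (by simpa using hu) ?_
      rintro rfl; simp at h1
    have hc := Finset.card_erase_of_mem hu
    have := ih (K.link {u}) hK.link ((g2_link_le (by omega) hK huK).trans hg) (τ.erase u)
      (by omega) (by omega) (by
        intro ρ hρ
        have huρ : u ∉ ρ := fun hh => by simpa using hρ.1 hh
        refine mem_link.2 ⟨huρ, h _ ?_⟩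
        refine lt_of_le_of_ne ?_ ?_
        · intro r hr
          rcases Finset.mem_insert.1 hr with rfl | hr
          · exact hu
          · exact Finset.mem_of_mem_erase (hρ.1 hr)
        · intro e
          apply hρ.ne
          rw [← e, Finset.erase_insert huρ])
    have := (mem_link.1 this).2
    rwa [Finset.insert_erase hu] at this

/-- From a simplex boundary in a vertex link to a simplex boundary. -/
lemma bd_of_link {K : SComplex} {d u : ℕ} (hp : K.IsPrime d) {σ : Finset ℕ} (hd : 1 ≤ d)
    (hσ : σ.card = d + 1) (h : ∀ τ ⊂ σ, τ ∈ (K.link {u}).faces) :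
    u ∉ σ ∧ ∀ τ ⊂ insert u σ, τ ∈ K.faces := by
  have hu : u ∉ σ := by
    intro hu
    have : {u} ∈ (K.link {u}).faces := by
      apply h
      refine lt_of_le_of_ne (by simpa using hu) ?_
      rintro rfl; simp at hσ; omega
    have := (mem_link.1 this).1
    simp at this
  refine ⟨hu, ?_⟩
  have hσK : σ ∈ K.faces := by
    by_contra hn
    exact hp σ hσ ⟨hn, fun τ hτ =>
      K.down _ (mem_link.1 (h τ hτ)).2 _ (Finset.subset_insert _ _)⟩
  intro τ hτ
  by_cases hut : u ∈ τ
  · have : τ.erase u ⊂ σ := by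
      refine lt_of_le_of_ne ?_ ?_
      · intro x hx
        simp at hx
        have := hτ.1 hx.2
        simp at this; tauto
      · intro e
        apply hτ.ne
        rw [← e, Finset.insert_erase hut]
    have := (mem_link.1 (h _ this)).2
    rwa [Finset.insert_erase hut] at this
  · refine K.down _ hσK _ ?_
    intro x hx
    have := hτ.1 hx
    simp at this
    rcases this with rfl | h
    · exact absurd hx hut
    · exact h

lemma NP1_edges {L : SComplex} (hL : L.NP 1) : L.fVec 1 = L.vertexSet.card := by
  classical
  have key := Finset.sum_card_bipartiteAbove_eq_sum_card_bipartiteBelow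
    (s := L.vertexSet) (t := L.faces.filter fun e => e.card = 2)
    (fun (w : ℕ) (e : Finset ℕ) => w ∈ e)
  have h1 : ∀ w ∈ L.vertexSet,
      (Finset.bipartiteAbove (fun (w : ℕ) (e : Finset ℕ) => w ∈ e)
        (L.faces.filter fun e => e.card = 2) w).card = 2 := by
    intro w hw
    have := hL.2.1 {w} (mem_V.1 hw) (by simp)
    refine Eq.trans ?_ this
    congr 1
    ext e
    simp [Finset.bipartiteAbove]
    tauto
  have h2 : ∀ e ∈ L.faces.filter (fun e => e.card = 2),
      (Finset.bipartiteBelow (fun (w : ℕ) (e : Finset ℕ) => w ∈ e) L.vertexSet e).card = 2 := by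
    intro e he
    have hs := sub_V (Finset.mem_filter.1 he).1
    refine Eq.trans ?_ (Finset.mem_filter.1 he).2
    congr 1
    ext x
    simp only [Finset.bipartiteBelow, Finset.mem_filter]
    exact ⟨fun h => h.2, fun h => ⟨hs h, h⟩⟩
  rw [Finset.sum_congr rfl h1, Finset.sum_congr rfl h2] at key
  simp at key
  rw [key]; rfl

end SComplex

namespace SComplex

lemma clique3 {K : SComplex} (hK : K.NP 3) (hg : K.g2 3 ≤ 0) (hp : K.IsPrime 3) :
    ∀ τ : Finset ℕ, τ.Nonempty → τ.card ≤ 4 →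
      (∀ x ∈ τ, ∀ y ∈ τ, ({x, y} : Finset ℕ) ∈ K.faces) → τ ∈ K.faces := by
  intro τ
  induction τ using Finset.strongInduction with
  | H τ ih =>
    intro hne hc h
    have hsub : ∀ ρ ⊂ τ, ρ ∈ K.faces := by
      intro ρ hρ
      rcases ρ.eq_empty_or_nonempty with rfl | hn
      · obtain ⟨x, hx⟩ := hne
        exact K.down _ (h x hx x hx) _ (by simp)
      · exact ih ρ hρ hn ((Finset.card_le_card hρ.1).trans hc)
          (fun x hx y hy => h x (hρ.1 hx) y (hρ.1 hy))
    have hpos := hne.card_pos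
    by_cases h4 : τ.card = 4
    · by_contra hn
      exact hp τ h4 ⟨hn, hsub⟩
    by_cases h3 : τ.card = 3
    · exact no_missing 2 le_rfl K hK hg τ (by omega) (by omega) hsub
    by_cases h2 : τ.card = 2
    · obtain ⟨x, y, -, rfl⟩ := Finset.card_eq_two.1 h2
      exact h x (by simp) y (by simp)
    · obtain ⟨x, rfl⟩ := Finset.card_eq_one.1 (by omega : τ.card = 1)
      have := h x (by simp) x (by simp)
      simpa using this

lemma eIn_union {K : SComplex} (A B : Finset ℕ) :
    (K.eIn A).card + (K.eIn B).card ≤ (K.eIn (A ∪ B)).card + (K.eIn (A ∩ B)).card := by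
  classical
  rw [← Finset.card_union_add_card_inter]
  refine Nat.add_le_add (Finset.card_le_card ?_) (Finset.card_le_card ?_)
  · intro e he
    rcases Finset.mem_union.1 he with he | he <;> rw [mem_eIn] at he ⊢
    · exact ⟨he.1, he.2.1, he.2.2.trans Finset.subset_union_left⟩
    · exact ⟨he.1, he.2.1, he.2.2.trans Finset.subset_union_right⟩
  · intro e he
    rw [Finset.mem_inter, mem_eIn, mem_eIn] at he
    exact mem_eIn.2 ⟨he.1.1, he.1.2.1, Finset.subset_inter he.1.2.2 he.2.2.2⟩

lemma mem_V_link2 {K : SComplex} {u v w : ℕ} (huv : u ≠ v) :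
    w ∈ ((K.link {u}).link {v}).vertexSet ↔ w ≠ u ∧ w ≠ v ∧ ({u, v, w} : Finset ℕ) ∈ K.faces := by
  rw [mem_V_link, mem_link]
  simp only [Finset.mem_insert, Finset.mem_singleton, not_or]
  constructor
  · rintro ⟨h1, ⟨-, h2⟩, h3⟩; exact ⟨Ne.symm h2, h1, h3⟩
  · rintro ⟨h1, h2, h3⟩; exact ⟨h2, ⟨huv, Ne.symm h1⟩, h3⟩

lemma mem_edge_link2 {K : SComplex} {u v a b : ℕ} (hau : a ≠ u) (hav : a ≠ v)
    (hbu : b ≠ u) (hbv : b ≠ v) (huv : u ≠ v) :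
    ({a, b} : Finset ℕ) ∈ ((K.link {u}).link {v}).faces ↔
      ({u, v, a, b} : Finset ℕ) ∈ K.faces := by
  rw [mem_link, mem_link]
  simp [hau.symm, hav.symm, hbu.symm, hbv.symm, huv]

lemma pair_cases {u v a b x y : ℕ} (hx : x ∈ ({u, v, a, b} : Finset ℕ))
    (hy : y ∈ ({u, v, a, b} : Finset ℕ)) :
    ({x, y} : Finset ℕ) ⊆ {u, v, a} ∨ ({x, y} : Finset ℕ) ⊆ {u, v, b} ∨
      ({x, y} : Finset ℕ) ⊆ {a, b} := by
  simp only [Finset.mem_insert, Finset.mem_singleton] at hx hy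
  simp only [Finset.insert_subset_iff, Finset.singleton_subset_iff,
    Finset.mem_insert, Finset.mem_singleton]
  rcases hx with rfl | rfl | rfl | rfl <;> rcases hy with rfl | rfl | rfl | rfl <;> simp

lemma five_cases {r x a b c d e : ℕ} (h : r ≠ x ∧ (r = a ∨ r = b ∨ r = c ∨ r = d ∨ r = e)) :
    (x = a → r ∈ ({b, c, d, e} : Finset ℕ)) ∧ (x = b → r ∈ ({a, c, d, e} : Finset ℕ)) ∧
    (x = c → r ∈ ({a, b, d, e} : Finset ℕ)) ∧ (x = d → r ∈ ({e, a, b, c} : Finset ℕ)) ∧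
    (x = e → r ∈ ({d, a, b, c} : Finset ℕ)) := by
  simp only [Finset.mem_insert, Finset.mem_singleton]
  obtain ⟨h, h'⟩ := h
  refine ⟨?_, ?_, ?_, ?_, ?_⟩ <;> rintro rfl <;> tauto

lemma edge_link3 {K : SComplex} (hK : K.NP 3) (hg : K.g2 3 ≤ 0) (hp : K.IsPrime 3)
    {u v : ℕ} (huv : u ≠ v) (he : ({u, v} : Finset ℕ) ∈ K.faces) :
    ((K.link {u}).link {v}).vertexSet.card ≤ 3 := by
  classical
  have hu : {u} ∈ K.faces := K.down _ he _ (by simp)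
  have hv : {v} ∈ K.faces := K.down _ he _ (by simp)
  have hNP1 : ((K.link {u}).link {v}).NP 1 := NP.link (NP.link hK)
  have hE := NP1_edges hNP1
  set L := (K.link {u}).link {v} with hL
  have hmV : ∀ w, w ∈ L.vertexSet ↔ w ≠ u ∧ w ≠ v ∧ ({u, v, w} : Finset ℕ) ∈ K.faces :=
    fun w => mem_V_link2 huv
  obtain ⟨F, hF, hs, hFc⟩ := hK.1.2 _ hu
  have k1 := g2_sub (by omega) hK hF hFc
    ((facet_sub_cs hF (hs (by simp))).trans Finset.subset_union_left)
    (Finset.union_subset (cs_sub hu) (cs_sub hv))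
  have k2 := star_lb (d := 2) le_rfl hK hu
  have k3 := star_lb (d := 2) le_rfl hK hv
  have k4 := eIn_union (K := K) (K.cs u) (K.cs v)
  have k5 := Finset.card_union_add_card_inter (K.cs u) (K.cs v)
  have hmcs : ∀ x w : ℕ, w ∈ K.cs x ↔ w = x ∨ (w ≠ x ∧ ({x, w} : Finset ℕ) ∈ K.faces) := by
    intro x w; simp only [cs, Finset.mem_insert, mem_V_link]
  have hcap : K.cs u ∩ K.cs v = insert u (insert v L.vertexSet) := by
    ext w
    rw [Finset.mem_inter, hmcs, hmcs, Finset.mem_insert, Finset.mem_insert, hmV]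
    constructor
    · rintro ⟨h1, h2⟩
      rcases h1 with h1 | ⟨h1, h1'⟩
      · exact Or.inl h1
      rcases h2 with h2 | ⟨h2, h2'⟩
      · exact Or.inr (Or.inl h2)
      · exact Or.inr (Or.inr ⟨h1, h2,
          no_missing_tri (d := 2) le_rfl hK hg huv h1.symm h2.symm he h1' h2'⟩)
    · rintro (rfl | rfl | ⟨h1, h2, h3⟩)
      · exact ⟨Or.inl rfl, Or.inr ⟨huv, by rwa [Finset.pair_comm]⟩⟩
      · exact ⟨Or.inr ⟨huv.symm, he⟩, Or.inl rfl⟩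
      · refine ⟨Or.inr ⟨h1, K.down _ h3 _ ?_⟩, Or.inr ⟨h2, K.down _ h3 _ ?_⟩⟩ <;>
        · intro r hr; simp at hr ⊢; tauto
  have hcc : (K.cs u ∩ K.cs v).card = L.vertexSet.card + 2 := by
    rw [hcap, Finset.card_insert_of_notMem, Finset.card_insert_of_notMem]
    · rw [hmV]; tauto
    · rw [Finset.mem_insert, hmV]; tauto
  have hin : (K.eIn (K.cs u ∩ K.cs v)).card ≤ 1 + 3 * L.vertexSet.card := by
    have hsub : K.eIn (K.cs u ∩ K.cs v) ⊆ ({({u, v} : Finset ℕ)} : Finset (Finset ℕ)) ∪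
        (L.vertexSet.image (fun w => ({u, w} : Finset ℕ)) ∪
        (L.vertexSet.image (fun w => ({v, w} : Finset ℕ)) ∪
          L.faces.filter fun e => e.card = 1 + 1)) := by
      intro e h
      rw [hcap] at h
      obtain ⟨h1, h2, h3⟩ := mem_eIn.1 h
      obtain ⟨a, b, hab, rfl⟩ := Finset.card_eq_two.1 h2
      have ha := h3 (show a ∈ ({a, b} : Finset ℕ) by simp)
      have hb := h3 (show b ∈ ({a, b} : Finset ℕ) by simp)
      simp only [Finset.mem_union, Finset.mem_singleton, Finset.mem_image, Finset.mem_filter]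
      rw [Finset.mem_insert, Finset.mem_insert] at ha hb
      have pc := Finset.pair_comm a b
      rcases ha with rfl | rfl | ha
      · rcases hb with rfl | rfl | hb
        · exact absurd rfl hab
        · exact Or.inl rfl
        · exact Or.inr (Or.inl ⟨b, hb, rfl⟩)
      · rcases hb with rfl | rfl | hb
        · exact Or.inl pc
        · exact absurd rfl hab
        · exact Or.inr (Or.inr (Or.inl ⟨b, hb, rfl⟩))
      · rcases hb with rfl | rfl | hb
        · exact Or.inr (Or.inl ⟨a, ha, pc.symm⟩)
        · exact Or.inr (Or.inr (Or.inl ⟨a, ha, pc.symm⟩))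
        · refine Or.inr (Or.inr (Or.inr ⟨?_, h2⟩))
          obtain ⟨a1, a2, a3⟩ := (hmV a).1 ha
          obtain ⟨b1, b2, b3⟩ := (hmV b).1 hb
          rw [hL, mem_edge_link2 a1 a2 b1 b2 huv]
          refine clique3 hK hg hp _ (by simp) Finset.card_le_four ?_
          intro x hx y hy
          rcases pair_cases hx hy with h | h | h
          · exact K.down _ a3 _ h
          · exact K.down _ b3 _ h
          · exact K.down _ h1 _ h
    refine (Finset.card_le_card hsub).trans ?_
    refine (Finset.card_union_le _ _).trans ?_
    have c1 := Finset.card_union_le (L.vertexSet.image (fun w => ({u, w} : Finset ℕ)))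
        (L.vertexSet.image (fun w => ({v, w} : Finset ℕ)) ∪
          L.faces.filter fun e => e.card = 1 + 1)
    have c2 := Finset.card_union_le (L.vertexSet.image (fun w => ({v, w} : Finset ℕ)))
          (L.faces.filter fun e => e.card = 1 + 1)
    have c3 := Finset.card_image_le (s := L.vertexSet) (f := fun w => ({u, w} : Finset ℕ))
    have c4 := Finset.card_image_le (s := L.vertexSet) (f := fun w => ({v, w} : Finset ℕ))
    unfold fVec at hE
    rw [Finset.card_singleton]
    omega
  have e5 : Nat.choose 5 2 = 10 := by decide
  norm_num [e5] at k1 k2 k3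
  rw [hcc] at k5
  omega

lemma closing3 {K : SComplex} (hK : K.NP 3) (hg : K.g2 3 ≤ 0) (hp : K.IsPrime 3)
    {u v x y z : ℕ} (huv : u ≠ v) (hux : u ≠ x) (huy : u ≠ y) (huz : u ≠ z)
    (hvx : v ≠ x) (hvy : v ≠ y) (hvz : v ≠ z) (hxy : x ≠ y) (hxz : x ≠ z) (hyz : y ≠ z)
    (h1 : ({u, v, x, y} : Finset ℕ) ∈ K.faces) (h2 : ({u, v, x, z} : Finset ℕ) ∈ K.faces) :
    ({u, v, y, z} : Finset ℕ) ∈ K.faces := by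
  classical
  have hE := edge_link3 hK hg hp huv (K.down _ h1 _ (by intro r hr; simp at hr ⊢; tauto))
  rw [← mem_edge_link2 hux.symm hvx.symm huy.symm hvy.symm huv] at h1
  rw [← mem_edge_link2 hux.symm hvx.symm huz.symm hvz.symm huv] at h2
  rw [← mem_edge_link2 huy.symm hvy.symm huz.symm hvz.symm huv]
  have hN : ((K.link {u}).link {v}).NP 1 := NP.link (NP.link hK)
  set L := (K.link {u}).link {v} with hL
  have hV : ({x, y, z} : Finset ℕ) = L.vertexSet := by
    apply Finset.eq_of_subset_of_card_le
    · have a1 := sub_V h1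
      have a2 := sub_V h2
      intro r hr
      simp only [Finset.mem_insert, Finset.mem_singleton] at hr
      rcases hr with rfl | rfl | rfl
      · exact a1 (by simp)
      · exact a1 (by simp)
      · exact a2 (by simp)
    · rw [Finset.card_eq_three.2 ⟨x, y, z, hxy, hxz, hyz, rfl⟩]; exact hE
  have h3 := hN.2.1 {y} (L.down _ h1 _ (by simp)) (by simp)
  by_contra hn
  have : (L.faces.filter fun τ => {y} ⊆ τ ∧ τ.card = 1 + 1) ⊆ {{x, y}} := by
    intro e he
    rw [Finset.mem_filter] at he
    obtain ⟨e1, e2, e3⟩ := he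
    rw [Finset.mem_singleton]
    have hy : y ∈ e := by simpa using e2
    have hs := sub_V e1
    rw [← hV] at hs
    have hz : z ∉ e := by
      intro hz
      exact hn (L.down _ e1 _ (by intro r hr; simp at hr; rcases hr with rfl | rfl <;> assumption))
    apply Finset.eq_of_subset_of_card_le
    · intro r hr
      have := hs hr
      simp only [Finset.mem_insert, Finset.mem_singleton] at this ⊢
      rcases this with h | h | h
      · exact Or.inl h
      · exact Or.inr h
      · subst h; exact absurd hr hz
    · rw [Finset.card_pair hxy, e3]
  have := Finset.card_le_card this
  rw [h3] at this
  simp at this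

set_option maxHeartbeats 1000000 in
lemma base3 {K : SComplex} (hK : K.NP 3) (hne : K.faces.Nonempty) (hg : K.g2 3 ≤ 0)
    (hp : K.IsPrime 3) : ∃ ρ : Finset ℕ, ρ.card = 5 ∧ ∀ τ ⊂ ρ, τ ∈ K.faces := by
  classical
  obtain ⟨σ, hσ⟩ := hne
  obtain ⟨F, hF, -, hFc⟩ := hK.1.2 σ hσ
  obtain ⟨T, hT, hTc⟩ := Finset.exists_subset_card_eq (show 3 ≤ F.card by omega)
  have hr := hK.2.1 T (K.down _ hF _ hT) hTc
  obtain ⟨G, hG, hGF⟩ := Finset.exists_mem_ne (by omega) F (s := K.faces.filter fun τ => T ⊆ τ ∧ τ.card = 3 + 1)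
  rw [Finset.mem_filter] at hG
  obtain ⟨hGK, hTG, hGc⟩ := hG
  have ex : ∀ H : Finset ℕ, T ⊆ H → H.card = 4 → ∃ d, d ∉ T ∧ H = insert d T := by
    intro H h1 h2
    have : (H \ T).card = 1 := by rw [Finset.card_sdiff_of_subset h1]; omega
    obtain ⟨d, hd⟩ := Finset.card_eq_one.1 this
    have hdm : d ∈ H \ T := by rw [hd]; simp
    refine ⟨d, (Finset.mem_sdiff.1 hdm).2, ?_⟩
    rw [← Finset.sdiff_union_of_subset h1, hd]; rfl
  obtain ⟨d, hd, rfl⟩ := ex F hT hFc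
  obtain ⟨e, he, rfl⟩ := ex G hTG hGc
  have hde : d ≠ e := by rintro rfl; exact hGF rfl
  obtain ⟨a, b, c, hab, hac, hbc, rfl⟩ := Finset.card_eq_three.1 hTc
  simp only [Finset.mem_insert, Finset.mem_singleton, not_or] at hd he
  obtain ⟨hda, hdb, hdc⟩ := hd
  obtain ⟨hea, heb, hec⟩ := he
  change d ≠ a at hda
  change d ≠ b at hdb
  change d ≠ c at hdc
  change e ≠ a at hea
  change e ≠ b at heb
  change e ≠ c at hec
  have pm : ∀ {A B : Finset ℕ}, A ∈ K.faces → B ⊆ A → B ∈ K.faces :=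
    fun h h' => K.down _ h _ h'
  have f1 : ({a, b, d, e} : Finset ℕ) ∈ K.faces :=
    closing3 hK hg hp hab hac hda.symm hea.symm hbc hdb.symm heb.symm hdc.symm hec.symm hde
      (pm hF (by intro r hr; simp at hr ⊢; tauto)) (pm hGK (by intro r hr; simp at hr ⊢; tauto))
  have f2 : ({a, c, d, e} : Finset ℕ) ∈ K.faces :=
    closing3 hK hg hp hac hab hda.symm hea.symm hbc.symm hdc.symm hec.symm hdb.symm heb.symm hde
      (pm hF (by intro r hr; simp at hr ⊢; tauto)) (pm hGK (by intro r hr; simp at hr ⊢; tauto))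
  have f3 : ({b, c, d, e} : Finset ℕ) ∈ K.faces :=
    closing3 hK hg hp hbc hab.symm hdb.symm heb.symm hac.symm hdc.symm hec.symm hda.symm hea.symm hde
      (pm hF (by intro r hr; simp at hr ⊢; tauto)) (pm hGK (by intro r hr; simp at hr ⊢; tauto))
  refine ⟨{a, b, c, d, e}, ?_, ?_⟩
  · rw [Finset.card_insert_of_notMem, Finset.card_insert_of_notMem,
      Finset.card_eq_three.2 ⟨c, d, e, hdc.symm, hec.symm, hde, rfl⟩]
    · simp [hbc, hdb.symm, heb.symm]
    · simp [hab, hac, hda.symm, hea.symm]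
  · intro τ hτ
    obtain ⟨x, hx, hxτ⟩ := Finset.exists_of_ssubset hτ
    have hs : ∀ r ∈ τ, r ≠ x ∧ (r = a ∨ r = b ∨ r = c ∨ r = d ∨ r = e) := by
      intro r hr
      refine ⟨by rintro rfl; exact hxτ hr, by simpa using hτ.1 hr⟩
    simp only [Finset.mem_insert, Finset.mem_singleton] at hx
    rcases hx with hx | hx | hx | hx | hx
    · exact pm f3 fun r hr => (five_cases (hs r hr)).1 hx
    · exact pm f2 fun r hr => (five_cases (hs r hr)).2.1 hx
    · exact pm f1 fun r hr => (five_cases (hs r hr)).2.2.1 hx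
    · exact pm hGK fun r hr => (five_cases (hs r hr)).2.2.2.1 hx
    · exact pm hF fun r hr => (five_cases (hs r hr)).2.2.2.2 hx

theorem equality (d : ℕ) (hd : 2 ≤ d) : ∀ K : SComplex, K.NP (d + 1) → K.faces.Nonempty →
    K.g2 (d + 1) ≤ 0 → K.IsPrime (d + 1) →
    ∃ ρ : Finset ℕ, ρ.card = d + 3 ∧ ∀ τ ⊂ ρ, τ ∈ K.faces := by
  induction d, hd using Nat.le_induction with
  | base => intro K hK hne hg hp; exact base3 hK hne hg hp
  | succ n hn ih =>
    intro K hK hne hg hp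
    obtain ⟨σ, hσ⟩ := hne
    obtain ⟨F, hF, -, hFc⟩ := hK.1.2 σ hσ
    obtain ⟨u, hu⟩ : F.Nonempty := by rw [← Finset.card_pos]; omega
    have huK : {u} ∈ K.faces := K.down _ hF _ (by simpa using hu)
    obtain ⟨ρ, hρ, hb⟩ := ih (K.link {u}) hK.link (link_ne huK)
      ((g2_link_le (by omega) hK huK).trans hg) (by
        rintro τ hτ ⟨hm, hbd⟩
        have hut : u ∉ τ := by
          intro h
          have : {u} ∈ (K.link {u}).faces := by
            apply hbd
            refine lt_of_le_of_ne (by simpa using h) ?_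
            rintro rfl; simp at hτ
          have := (mem_link.1 this).1
          simp at this
        have hτK : τ ∈ K.faces := no_missing (n + 1) (by omega) K hK hg τ (by omega) (by omega)
          fun ρ hρ => K.down _ (mem_link.1 (hbd ρ hρ)).2 _ (Finset.subset_insert _ _)
        refine hp (insert u τ) (by rw [Finset.card_insert_of_notMem hut, hτ])
          ⟨fun h => hm (mem_link.2 ⟨hut, h⟩), ?_⟩
        intro ρ hρ
        by_cases hur : u ∈ ρ
        · have : ρ.erase u ⊂ τ := by
            refine lt_of_le_of_ne ?_ ?_
            · intro x hx
              simp at hx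
              have := hρ.1 hx.2
              simp at this; tauto
            · intro e
              apply hρ.ne
              rw [← e, Finset.insert_erase hur]
          have := (mem_link.1 (hbd _ this)).2
          rwa [Finset.insert_erase hur] at this
        · refine K.down _ hτK _ ?_
          intro x hx
          have := hρ.1 hx
          simp at this
          rcases this with rfl | h
          · exact absurd hx hur
          · exact h)
    obtain ⟨h1, h2⟩ := bd_of_link hp (by omega) hρ hb
    exact ⟨insert u ρ, by rw [Finset.card_insert_of_notMem h1, hρ], h2⟩

lemma ridge_closed {K : SComplex} {d : ℕ} (hK : K.NP d) {ρ : Finset ℕ} (hρ : ρ.card = d + 2)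
    (hb : ∀ τ ⊂ ρ, τ ∈ K.faces) {A B : Finset ℕ} (hA : A ⊆ ρ) (h : K.FacetAdj d A B) : B ⊆ ρ := by
  classical
  obtain ⟨hAK, hBK, hAc, hBc, hAB⟩ := h
  have hr := hK.2.1 (A ∩ B) (K.down _ hAK _ Finset.inter_subset_left) hAB
  have hR : A ∩ B ⊆ ρ := Finset.inter_subset_left.trans hA
  have hc : (ρ \ (A ∩ B)).card = 2 := by rw [Finset.card_sdiff_of_subset hR]; omega
  have himg : ((ρ \ (A ∩ B)).image fun x => ρ.erase x) =
      K.faces.filter fun τ => A ∩ B ⊆ τ ∧ τ.card = d + 1 := by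
    apply Finset.eq_of_subset_of_card_le
    · intro G hG
      obtain ⟨x, hx, rfl⟩ := Finset.mem_image.1 hG
      rw [Finset.mem_sdiff] at hx
      refine Finset.mem_filter.2 ⟨hb _ (Finset.erase_ssubset hx.1), ?_, ?_⟩
      · intro r hr
        exact Finset.mem_erase.2 ⟨by rintro rfl; exact hx.2 hr, hR hr⟩
      · rw [Finset.card_erase_of_mem hx.1]; omega
    · rw [hr, Finset.card_image_of_injOn, hc]
      intro x hx y hy hxy
      by_contra hne
      have : x ∈ ρ.erase y := Finset.mem_erase.2 ⟨hne, (Finset.mem_sdiff.1 hx).1⟩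
      have h' : ρ.erase x = ρ.erase y := hxy
      rw [← h'] at this
      simp at this
  have : B ∈ K.faces.filter fun τ => A ∩ B ⊆ τ ∧ τ.card = d + 1 :=
    Finset.mem_filter.2 ⟨hBK, Finset.inter_subset_right, hBc⟩
  rw [← himg] at this
  obtain ⟨x, -, rfl⟩ := Finset.mem_image.1 this
  exact Finset.erase_subset _ _

lemma g2_simplex {K : SComplex} {d : ℕ} (hK : K.NP d) (hs : K.StronglyConnected d)
    {ρ : Finset ℕ} (hρ : ρ.card = d + 2) (hd : 1 ≤ d)
    (hb : ∀ τ ⊂ ρ, τ ∈ K.faces) : K.g2 d ≤ 0 := by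
  classical
  obtain ⟨x, hx⟩ : ρ.Nonempty := by rw [← Finset.card_pos]; omega
  have h0 := hb _ (Finset.erase_ssubset hx)
  have hall : ∀ τ ∈ K.faces, τ ⊆ ρ := by
    intro τ hτ
    obtain ⟨F, hF, hτF, hFc⟩ := hK.1.2 τ hτ
    refine hτF.trans ?_
    have hch := hs _ h0 F hF (by rw [Finset.card_erase_of_mem hx]; omega) hFc
    clear hτF hFc hF
    induction hch with
    | refl => exact Finset.erase_subset _ _
    | tail _ h ih => exact ridge_closed hK hρ hb ih h
  have hV : K.vertexSet = ρ := by
    ext y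
    constructor
    · intro hy; exact hall _ (mem_V.1 hy) (by simp)
    · intro hy
      refine mem_V.2 (hb _ (lt_of_le_of_ne (by simpa using hy) ?_))
      rintro rfl; simp at hρ
  have hf1 : K.fVec 1 ≤ Nat.choose (d + 2) 2 := by
    rw [← hρ, ← Finset.card_powersetCard]
    apply Finset.card_le_card
    intro e he
    rw [Finset.mem_filter] at he
    exact Finset.mem_powersetCard.2 ⟨hall _ he.1, he.2⟩
  have h2 := two_choose' d
  unfold g2
  rw [fVec_zero, hV, hρ]
  zify at hf1
  push_cast
  nlinarith

end SComplex

theorem statement2 (d : ℕ) (hd : 4 ≤ d) (Δ : SComplex)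
    (hpm : Δ.IsNormalPseudomanifold d) (hprime : Δ.IsPrime d)
    (hg2 : 1 ≤ Δ.g2 d)
    (u : ℕ) (hu : ({u} : Finset ℕ) ∈ Δ.faces)
    (hlkprime : (Δ.link {u}).IsPrime (d - 1)) :
    1 ≤ (Δ.link {u}).g2 (d - 1) := by
  obtain ⟨e, rfl⟩ : ∃ e, d = e + 1 + 1 := ⟨d - 2, by omega⟩
  have hNP : Δ.NP (e + 1 + 1) := ⟨hpm.1, hpm.2.2⟩
  by_contra hcon
  have hN : (Δ.link {u}).NP (e + 1) := SComplex.NP.link hNP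
  obtain ⟨σ, hσ, hb⟩ := SComplex.equality e (by omega) (Δ.link {u}) hN (SComplex.link_ne hu)
    (by simp only [Nat.add_sub_cancel] at hcon; omega) hlkprime
  obtain ⟨h1, h2⟩ := SComplex.bd_of_link hprime (by omega) hσ hb
  have := SComplex.g2_simplex hNP hpm.2.1
    (by rw [Finset.card_insert_of_notMem h1, hσ]) (by omega) h2
  omega
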